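/- arXiv:2307.00358 — 11 statements merged into one kernel-verified Lean document; each statement's English description precedes it below -/
import Mathlib

section
/- For a differentiable function f: ℝⁿ → ℝ and a constant ν > 0, the following three conditions are equivalent: (i) ‖Df(u) − Df(v)‖ ≤ ν‖u − v‖ for all u, v ∈ ℝⁿ; (ii) |f(v) − f(u) − Df(u)·(v − u)| ≤ (ν/2)‖v − u‖² for all u, v ∈ ℝⁿ; (iii) f(v) ≤ f(u) + (1/2)(Df(u) + Df(v))·(v − u) + (ν/4)‖v − u‖² − (1/(4ν))‖Df(v) − Df(u)‖² for all u, v ∈ ℝⁿ. -/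
open scoped InnerProductSpace

section LipschitzGradient

variable {E : Type*} [NormedAddCommGroup E] [InnerProductSpace ℝ E]

/-- A function with `ν`-Lipschitz gradient differs from its first-order expansion by at most
`ν / 2 * ‖v - u‖ ^ 2`. -/
theorem abs_sub_inner_gradient_le_of_lipschitz [CompleteSpace E] {f : E → ℝ} {ν : ℝ}
    (hf : Differentiable ℝ f) (h : ∀ u v, ‖gradient f u - gradient f v‖ ≤ ν * ‖u - v‖) (u v : E) :
    |f v - f u - ⟪gradient f u, v - u⟫_ℝ| ≤ ν / 2 * ‖v - u‖ ^ 2 := by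
  set d := v - u with hd
  have hline (t : ℝ) : HasDerivAt (fun s : ℝ => u + s • d) d t := by
    simpa using ((hasDerivAt_id t).smul_const d).const_add u
  have hderiv (t : ℝ) : HasDerivAt (fun s : ℝ => f (u + s • d) - f u - s * ⟪gradient f u, d⟫_ℝ)
      ⟪gradient f (u + t • d) - gradient f u, d⟫_ℝ t := by
    have h1 := (hf (u + t • d)).hasGradientAt.hasFDerivAt.comp_hasDerivAt t (hline t)
    have h2 := (h1.sub_const (f u)).sub ((hasDerivAt_id t).mul_const ⟪gradient f u, d⟫_ℝ)
    exact h2.congr_deriv (by simp [inner_sub_left])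
  have hbound (t : ℝ) : HasDerivAt (fun s : ℝ => ν / 2 * ‖d‖ ^ 2 * s ^ 2) (ν * t * ‖d‖ ^ 2) t := by
    refine ((hasDerivAt_pow 2 t).const_mul (ν / 2 * ‖d‖ ^ 2)).congr_deriv ?_
    push_cast
    ring
  have key := image_norm_le_of_norm_deriv_right_le_deriv_boundary (a := 0) (b := 1)
    (fun t _ => (hderiv t).continuousAt.continuousWithinAt)
    (fun t _ => (hderiv t).hasDerivWithinAt) (by simp) hbound
    (fun t ht => by
      calc ‖⟪gradient f (u + t • d) - gradient f u, d⟫_ℝ‖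
          ≤ ‖gradient f (u + t • d) - gradient f u‖ * ‖d‖ := norm_inner_le_norm _ _
        _ ≤ ν * ‖u + t • d - u‖ * ‖d‖ := by gcongr; exact h _ _
        _ = ν * t * ‖d‖ ^ 2 := by
          rw [add_sub_cancel_left, norm_smul, Real.norm_of_nonneg ht.1]
          ring)
    (Set.right_mem_Icc.2 zero_le_one)
  simpa [hd, Real.norm_eq_abs] using key

/-- Two-sided quadratic bounds on the first-order remainder imply the interpolation inequality. -/
theorem interpolation_of_abs_sub_inner_le {f : E → ℝ} {F : E → E} {ν : ℝ} (hν : 0 < ν)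
    (h : ∀ u v, |f v - f u - ⟪F u, v - u⟫_ℝ| ≤ ν / 2 * ‖v - u‖ ^ 2) (u v : E) :
    f v ≤ f u + (1 / 2) * ⟪F u + F v, v - u⟫_ℝ
      + ν / 4 * ‖v - u‖ ^ 2 - 1 / (4 * ν) * ‖F v - F u‖ ^ 2 := by
  set d := v - u with hd
  set g := F v - F u with hg
  have hFv : F v = F u + g := by rw [hg]; abel
  set w := u + ((1 / 2 : ℝ) • d + (1 / (2 * ν)) • g) with hw
  have hwu : w - u = (1 / 2 : ℝ) • d + (1 / (2 * ν)) • g := by rw [hw]; abel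
  have hwv : w - v = (1 / (2 * ν)) • g - (1 / 2 : ℝ) • d := by
    rw [hw, hd]; module
  have h1 := (abs_le.1 (h u w)).2
  have h2 := (abs_le.1 (h v w)).1
  rw [hwu, norm_add_sq_real] at h1
  rw [hwv, norm_sub_sq_real] at h2
  simp only [hFv, inner_add_left, inner_add_right, inner_sub_right, real_inner_smul_left,
    real_inner_smul_right, norm_smul, mul_pow, real_inner_self_eq_norm_sq, Real.norm_eq_abs,
    sq_abs, real_inner_comm g d] at h1 h2 ⊢
  have e1 : ν * (1 / (2 * ν)) ^ 2 = 1 / (4 * ν) := by field_simp; norm_num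
  have e2 : 1 / (2 * ν) = 2 * (1 / (4 * ν)) := by field_simp; norm_num
  have e3 := congrArg (· * ‖g‖ ^ 2) e1
  have e4 := congrArg (· * ‖g‖ ^ 2) e2
  linarith

/-- The interpolation inequality implies that the vector field in it is `ν`-Lipschitz. -/
theorem norm_sub_le_of_interpolation {f : E → ℝ} {F : E → E} {ν : ℝ} (hν : 0 < ν)
    (h : ∀ u v, f v ≤ f u + (1 / 2) * ⟪F u + F v, v - u⟫_ℝ
      + ν / 4 * ‖v - u‖ ^ 2 - 1 / (4 * ν) * ‖F v - F u‖ ^ 2) (u v : E) :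
    ‖F u - F v‖ ≤ ν * ‖u - v‖ := by
  have h1 := h u v
  have h2 := h v u
  rw [norm_sub_rev v u, norm_sub_rev (F v), ← neg_sub u v, inner_neg_right] at h1
  rw [add_comm (F v)] at h2
  have h3 : 1 / (4 * ν) * ‖F u - F v‖ ^ 2 ≤ ν / 4 * ‖u - v‖ ^ 2 := by linarith
  refine (sq_le_sq₀ (by positivity) (by positivity)).1 ?_
  calc ‖F u - F v‖ ^ 2 = 4 * ν * (1 / (4 * ν) * ‖F u - F v‖ ^ 2) := by field_simp
    _ ≤ 4 * ν * (ν / 4 * ‖u - v‖ ^ 2) := by gcongr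
    _ = (ν * ‖u - v‖) ^ 2 := by ring

end LipschitzGradient

/-- For a differentiable `f : ℝⁿ → ℝ` and `ν > 0`, the Lipschitz-gradient condition,
the quadratic-upper-bound condition, and the interpolation-type inequality are equivalent. -/
theorem stmt_0 (n : ℕ) (ν : ℝ) (hν : 0 < ν)
    (f : EuclideanSpace ℝ (Fin n) → ℝ) (hf : Differentiable ℝ f) :
    List.TFAE [
      ∀ u v : EuclideanSpace ℝ (Fin n), ‖gradient f u - gradient f v‖ ≤ ν * ‖u - v‖,
      ∀ u v : EuclideanSpace ℝ (Fin n),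
        |f v - f u - ⟪gradient f u, v - u⟫_ℝ| ≤ ν / 2 * ‖v - u‖ ^ 2,
      ∀ u v : EuclideanSpace ℝ (Fin n),
        f v ≤ f u + (1 / 2) * ⟪gradient f u + gradient f v, v - u⟫_ℝ
          + ν / 4 * ‖v - u‖ ^ 2 - 1 / (4 * ν) * ‖gradient f v - gradient f u‖ ^ 2] := by
  tfae_have 1 → 2 := fun h => abs_sub_inner_gradient_le_of_lipschitz hf h
  tfae_have 2 → 3 := fun h => interpolation_of_abs_sub_inner_le hν h
  tfae_have 3 → 1 := fun h => norm_sub_le_of_interpolation hν h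
  tfae_finish
end

section
/- Let Θ = {x₁,…,x_{n+1}} ⊂ ℝⁿ be affinely independent and let x ∈ ℝⁿ be such that, for a given k ∈ {1,…,n+1}, the set Θ \ {x_k} ∪ {x} is also affinely independent. Let ℓ_k(x) be the barycentric coordinate of x with respect to Θ corresponding to x_k (necessarily ℓ_k(x) ≠ 0). Let f: ℝⁿ → ℝ, let f̂ be the affine function interpolating f on Θ, and let ĥ be the affine function interpolating f on Θ \ {x_k} ∪ {x}. Then ĥ(x_k) − f(x_k) = (f̂(x) − f(x)) / (−ℓ_k(x)). -/
/-- An affine map to a vector space commutes with affine combinations. -/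
theorem AffineMap.map_sum_smul_of_sum_eq_one {ι V W : Type*} [Fintype ι]
    [AddCommGroup V] [Module ℝ V] [AddCommGroup W] [Module ℝ W]
    (g : V →ᵃ[ℝ] W) (x : ι → V) (w : ι → ℝ) (hw : ∑ i, w i = 1) :
    g (∑ i, w i • x i) = ∑ i, w i • g (x i) := by
  have h (y : V) : g y = g.linear y + g 0 := congrFun g.decomp y
  simp only [h (∑ i, w i • x i), fun i => h (x i), map_sum, map_smul, smul_add,
    Finset.sum_add_distrib, ← Finset.sum_smul, hw, one_smul]

/-- If replacing `x k` by an affine combination of the `x i` gives an affinely independent family,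
then the weight of `x k` in that combination is nonzero. -/
theorem AffineIndependent.weight_ne_zero_of_update {ι V : Type*} [Fintype ι] [DecidableEq ι]
    [AddCommGroup V] [Module ℝ V] {x : ι → V} {p : V} {k : ι}
    (h : AffineIndependent ℝ (Function.update x k p))
    {w : ι → ℝ} (hw : ∑ i, w i = 1) (hp : ∑ i, w i • x i = p) : w k ≠ 0 := by
  intro hk
  have hcomb : ∑ i, w i • Function.update x k p i = p := by
    rw [← hp]
    refine Finset.sum_congr rfl fun i _ => ?_
    rcases eq_or_ne i k with rfl | hi
    · simp [hk]
    · simp [hi]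
  have hzero := affineIndependent_iff.1 h Finset.univ (w - Pi.single k 1)
    (by simp [Finset.sum_sub_distrib, hw])
    (by simp [sub_smul, Finset.sum_sub_distrib, hcomb, Pi.single_apply, ite_smul])
    k (Finset.mem_univ k)
  simp [hk] at hzero

/-- Swapping the interpolation point `x` with a sample point `x_k`: the error of the new
interpolant at `x_k` is the error of the old interpolant at `x` divided by `-ℓ_k(x)`. -/
theorem stmt_2 (n : ℕ)
    (x : Fin (n + 1) → EuclideanSpace ℝ (Fin n)) (hx : AffineIndependent ℝ x)
    (p : EuclideanSpace ℝ (Fin n)) (k : Fin (n + 1))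
    (hswap : AffineIndependent ℝ (Function.update x k p))
    (ℓ : Fin (n + 1) → ℝ) (hsum : ∑ i, ℓ i = 1) (hbary : ∑ i, ℓ i • x i = p)
    (f : EuclideanSpace ℝ (Fin n) → ℝ)
    (fhat hhat : EuclideanSpace ℝ (Fin n) →ᵃ[ℝ] ℝ)
    (hfhat : ∀ i, fhat (x i) = f (x i))
    (hhhat : ∀ i, hhat (Function.update x k p i) = f (Function.update x k p i)) :
    ℓ k ≠ 0 ∧ hhat (x k) - f (x k) = (fhat p - f p) / (-(ℓ k)) := by
  have hk : ℓ k ≠ 0 := hswap.weight_ne_zero_of_update hsum hbary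
  refine ⟨hk, ?_⟩
  have hp : hhat p = f p := by simpa using hhhat k
  have hdiff : (hhat - fhat) p = ℓ k * (hhat - fhat) (x k) := by
    rw [← hbary, AffineMap.map_sum_smul_of_sum_eq_one _ x ℓ hsum, ← smul_eq_mul]
    refine Finset.sum_eq_single k (fun i _ hi => ?_) (by simp)
    have hi' : hhat (x i) = f (x i) := by simpa [hi] using hhhat i
    simp [hi', hfhat i]
  have herr : f p - fhat p = ℓ k * (hhat (x k) - f (x k)) := by
    simpa [hp, hfhat k] using hdiff
  rw [eq_div_iff (neg_ne_zero.2 hk)]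
  linear_combination herr
end

section
/- Assume f ∈ C¹,¹_ν(ℝⁿ). Let f̂ be the affine function interpolating f on an affinely independent set Θ = {x₁,…,x_{n+1}} ⊂ ℝⁿ, and let x ∈ ℝⁿ have barycentric coordinates ℓ₁,…,ℓ_{n+1} with respect to Θ. Then for every u ∈ ℝⁿ, |f̂(x) − f(x)| ≤ (ν/2)(‖x − u‖² + Σ_{i=1}^{n+1} |ℓ_i| ‖x_i − u‖²). -/
open scoped InnerProductSpace

/-- The first-order Taylor remainder of a function with `ν`-Lipschitz gradient is at most
`ν / 2` times the squared distance. -/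
theorem abs_taylor_remainder_le_of_lipschitz_gradient {E : Type*} [NormedAddCommGroup E]
    [InnerProductSpace ℝ E] [CompleteSpace E] {f : E → ℝ} {ν : ℝ} (hdiff : Differentiable ℝ f)
    (hlip : ∀ u v, ‖gradient f u - gradient f v‖ ≤ ν * ‖u - v‖) (u y : E) :
    |f y - f u - ⟪gradient f u, y - u⟫_ℝ| ≤ ν / 2 * ‖y - u‖ ^ 2 := by
  set d := y - u with hd
  have hderiv (t : ℝ) : HasDerivAt (fun t : ℝ => f (u + t • d) - f u - t * ⟪gradient f u, d⟫_ℝ)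
      (⟪gradient f (u + t • d) - gradient f u, d⟫_ℝ) t := by
    have hline : HasDerivAt (fun t : ℝ => u + t • d) d t := by
      simpa using ((hasDerivAt_id t).smul_const d).const_add u
    have hcomp := (hdiff (u + t • d)).hasGradientAt.hasFDerivAt.comp_hasDerivAt t hline
    have hlin := (hasDerivAt_id t).mul_const ⟪gradient f u, d⟫_ℝ
    exact ((hcomp.sub_const (f u)).sub hlin).congr_deriv (by simp [inner_sub_left])
  have hbound (t : ℝ) : HasDerivAt (fun t : ℝ => ν / 2 * ‖d‖ ^ 2 * t ^ 2) (ν * ‖d‖ ^ 2 * t) t := by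
    exact ((hasDerivAt_pow 2 t).const_mul (ν / 2 * ‖d‖ ^ 2)).congr_deriv (by norm_num; ring)
  have key := image_norm_le_of_norm_deriv_right_le_deriv_boundary (a := 0) (b := 1)
    (fun t _ => (hderiv t).continuousAt.continuousWithinAt)
    (fun t _ => (hderiv t).hasDerivWithinAt) (by simp) hbound
    (fun t ht => by
      calc ‖⟪gradient f (u + t • d) - gradient f u, d⟫_ℝ‖
          ≤ ‖gradient f (u + t • d) - gradient f u‖ * ‖d‖ := norm_inner_le_norm _ _
        _ ≤ ν * ‖u + t • d - u‖ * ‖d‖ := by gcongr; exact hlip _ _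
        _ = ν * ‖d‖ ^ 2 * t := by
          rw [add_sub_cancel_left, norm_smul, Real.norm_of_nonneg ht.1]
          ring)
    (Set.right_mem_Icc.2 zero_le_one)
  simpa [hd] using key

/-- An affine map commutes with affine combinations. -/
theorem AffineMap.apply_sum_smul {ι E F : Type*} [Fintype ι] [AddCommGroup E] [Module ℝ E]
    [AddCommGroup F] [Module ℝ F] (g : E →ᵃ[ℝ] F) (x : ι → E) (w : ι → ℝ) (hw : ∑ i, w i = 1) :
    g (∑ i, w i • x i) = ∑ i, w i • g (x i) := by
  have h (y : E) : g y = g.linear y + g 0 := congrFun g.decomp y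
  rw [h]
  simp_rw [h (x _), smul_add, Finset.sum_add_distrib, ← Finset.sum_smul, hw, one_smul, map_sum,
    map_smul]

/-- Error bound for linear interpolation/extrapolation with a free point `u`. -/
theorem stmt_3 (n : ℕ) (ν : ℝ) (hν : 0 < ν)
    (f : EuclideanSpace ℝ (Fin n) → ℝ)
    (hdiff : Differentiable ℝ f)
    (hlip : ∀ u v, ‖gradient f u - gradient f v‖ ≤ ν * ‖u - v‖)
    (x : Fin (n + 1) → EuclideanSpace ℝ (Fin n)) (hx : AffineIndependent ℝ x)
    (p : EuclideanSpace ℝ (Fin n)) (ℓ : Fin (n + 1) → ℝ)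
    (hsum : ∑ i, ℓ i = 1) (hbary : ∑ i, ℓ i • x i = p)
    (fhat : EuclideanSpace ℝ (Fin n) →ᵃ[ℝ] ℝ)
    (hfhat : ∀ i, fhat (x i) = f (x i)) :
    ∀ u : EuclideanSpace ℝ (Fin n),
      |fhat p - f p| ≤ ν / 2 * (‖p - u‖ ^ 2 + ∑ i, |ℓ i| * ‖x i - u‖ ^ 2) := by
  intro u
  set R := fun y => f y - f u - ⟪gradient f u, y - u⟫_ℝ with hR_def
  have hR (y) : |R y| ≤ ν / 2 * ‖y - u‖ ^ 2 :=
    abs_taylor_remainder_le_of_lipschitz_gradient hdiff hlip u y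
  have hfhat_p : fhat p = ∑ i, ℓ i * f (x i) := by
    rw [← hbary, fhat.apply_sum_smul x ℓ hsum]
    simp [hfhat]
  have hinner : ⟪gradient f u, p⟫_ℝ = ∑ i, ℓ i * ⟪gradient f u, x i⟫_ℝ := by
    simp [← hbary, inner_sum, inner_smul_right]
  have herr : fhat p - f p = ∑ i, ℓ i * R (x i) - R p := by
    simp only [hR_def, inner_sub_right, mul_sub, Finset.sum_sub_distrib, ← Finset.sum_mul, hsum,
      hfhat_p, hinner]
    ring
  calc |fhat p - f p| ≤ |∑ i, ℓ i * R (x i)| + |R p| := herr ▸ abs_sub _ _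
    _ ≤ ∑ i, |ℓ i| * (ν / 2 * ‖x i - u‖ ^ 2) + ν / 2 * ‖p - u‖ ^ 2 := by
      gcongr
      · refine (Finset.abs_sum_le_sum_abs _ _).trans (Finset.sum_le_sum fun i _ => ?_)
        rw [abs_mul]
        gcongr
        exact hR _
      · exact hR _
    _ = ν / 2 * (‖p - u‖ ^ 2 + ∑ i, |ℓ i| * ‖x i - u‖ ^ 2) := by
      rw [mul_add, Finset.mul_sum, add_comm]
      congr 1
      exact Finset.sum_congr rfl fun i _ => by ring
end

section
/- Let Θ = {x₁,…,x_{n+1}} ⊂ ℝⁿ be affinely independent, let x ∈ ℝⁿ have barycentric coordinates ℓ₁,…,ℓ_{n+1} with respect to Θ, set x₀ = x, ℓ₀ = −1, and assume ℓ_i ≠ 0 for every i ∈ {1,…,n+1}. Let G = Σ_{i=0}^{n+1} ℓ_i x_i x_iᵀ, and let I₊ = {i ∈ {0,1,…,n+1}: ℓ_i > 0} and I₋ = {i ∈ {0,1,…,n+1}: ℓ_i < 0}. Then G has exactly |I₊| − 1 positive eigenvalues and exactly |I₋| − 1 negative eigenvalues (counted with multiplicity). -/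
open Matrix

open QuadraticMap in
/-- Two diagonal real quadratic forms in the same number of variables that are related by an
injective linear substitution have the same numbers of positive and negative weights. -/
theorem card_pos_neg_weights_eq_of_injective {ι : Type*} [Fintype ι] (w w' : ι → ℝ)
    (f : (ι → ℝ) →ₗ[ℝ] (ι → ℝ)) (hf : Function.Injective f)
    (hw : ∀ y, ∑ i, w' i * f y i ^ 2 = ∑ i, w i * y i ^ 2) :
    (Finset.univ.filter fun i => 0 < w i).card = (Finset.univ.filter fun i => 0 < w' i).card ∧
    (Finset.univ.filter fun i => w i < 0).card = (Finset.univ.filter fun i => w' i < 0).card := by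
  have e : Equivalent (weightedSumSquares ℝ w) (weightedSumSquares ℝ w') :=
    ⟨{ LinearEquiv.ofInjectiveEndo f hf with
       map_app' := fun y => by
        simpa [weightedSumSquares_apply, pow_two] using hw y }⟩
  have hpos := e.sigPos_eq
  have hneg := e.sigNeg_eq
  rw [QuadraticForm.sigPos_weightedSumSquares, QuadraticForm.sigPos_weightedSumSquares] at hpos
  rw [QuadraticForm.sigNeg_weightedSumSquares, QuadraticForm.sigNeg_weightedSumSquares] at hneg
  simpa [Set.ncard_eq_toFinset_card'] using And.intro hpos hneg

/-- A Hermitian real matrix is diagonalized by the orthogonal matrix of its eigenvectors. -/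
theorem Matrix.IsHermitian.dotProduct_mulVec_eigenvectorUnitary {ι : Type*} [Fintype ι]
    [DecidableEq ι] {A : Matrix ι ι ℝ} (hA : A.IsHermitian) (z : ι → ℝ) :
    ((hA.eigenvectorUnitary : Matrix ι ι ℝ) *ᵥ z) ⬝ᵥ
        (A *ᵥ ((hA.eigenvectorUnitary : Matrix ι ι ℝ) *ᵥ z)) =
      ∑ i, hA.eigenvalues i * z i ^ 2 := by
  have h := hA.conjStarAlgAut_star_eigenvectorUnitary
  rw [Unitary.conjStarAlgAut_star_apply, star_eq_conjTranspose,
    conjTranspose_eq_transpose_of_trivial] at h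
  rw [dotProduct_comm, dotProduct_mulVec, ← mulVec_transpose, mulVec_mulVec, mulVec_mulVec, h]
  simp only [dotProduct, mulVec_diagonal]
  exact Finset.sum_congr rfl fun i _ => by simp; ring

/-- A vector having the same dot product with all vertices of a simplex of full dimension
vanishes. -/
theorem AffineIndependent.eq_zero_of_dotProduct_eq {n : ℕ} {x : Fin (n + 1) → (Fin n → ℝ)}
    (hx : AffineIndependent ℝ x) {v : Fin n → ℝ} {c : ℝ} (hv : ∀ i, x i ⬝ᵥ v = c) : v = 0 := by
  have htop := hx.vectorSpan_eq_top_of_card_eq_finrank_add_one (by simp)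
  rw [vectorSpan_range_eq_span_range_vsub_right ℝ x 0] at htop
  have hle : Submodule.span ℝ (Set.range fun i => x i -ᵥ x 0) ≤
      LinearMap.ker (dotProductBilin ℝ ℝ v) := by
    rw [Submodule.span_le]
    rintro _ ⟨i, rfl⟩
    simp [dotProduct_comm v, sub_dotProduct, hv]
  have hmem : v ∈ LinearMap.ker (dotProductBilin ℝ ℝ v) := hle (htop ▸ Submodule.mem_top)
  exact dotProduct_self_eq_zero.mp (by simpa using hmem)

/-- If `∑ i, ℓ i = 1`, a weighted sum of squares of the affine functionals `c + (x i - p) ⬝ᵥ v`,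
with `p` the weighted mean of the `x i`, splits off the square of its constant term. -/
theorem sum_mul_add_dotProduct_sq {ι κ : Type*} [Fintype ι] [Fintype κ] (x : ι → κ → ℝ)
    (p : κ → ℝ) (ℓ : ι → ℝ) (hsum : ∑ i, ℓ i = 1) (hbary : ∑ i, ℓ i • x i = p)
    (c : ℝ) (v : κ → ℝ) :
    ∑ i, ℓ i * (c + (x i - p) ⬝ᵥ v) ^ 2 =
      c ^ 2 + v ⬝ᵥ (((-1 : ℝ) • vecMulVec p p + ∑ i, ℓ i • vecMulVec (x i) (x i)) *ᵥ v) := by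
  have hp : ∑ i, ℓ i * (x i ⬝ᵥ v) = p ⬝ᵥ v := by
    simp [← hbary, sum_dotProduct]
  have hG : v ⬝ᵥ (((-1 : ℝ) • vecMulVec p p + ∑ i, ℓ i • vecMulVec (x i) (x i)) *ᵥ v) =
      -(p ⬝ᵥ v) ^ 2 + ∑ i, ℓ i * (x i ⬝ᵥ v) ^ 2 := by
    rw [dotProduct_comm]
    simp only [add_mulVec, sum_mulVec, smul_mulVec, vecMulVec_mulVec, add_dotProduct,
      sum_dotProduct, smul_dotProduct, op_smul_eq_smul, smul_eq_mul, pow_two, neg_one_mul]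
  calc
    _ = (c - p ⬝ᵥ v) ^ 2 * ∑ i, ℓ i + 2 * (c - p ⬝ᵥ v) * ∑ i, ℓ i * (x i ⬝ᵥ v) +
        ∑ i, ℓ i * (x i ⬝ᵥ v) ^ 2 := by
      simp only [Finset.mul_sum, ← Finset.sum_add_distrib, sub_dotProduct]
      exact Finset.sum_congr rfl fun i _ => by ring
    _ = _ := by rw [hsum, hp, hG]; ring

/-- Counting eigenvalues of `G = Σ_{i=0}^{n+1} ℓ_i x_i x_iᵀ` (with `x₀ = x`, `ℓ₀ = −1`):
the number of positive eigenvalues is `|I₊| − 1` and the number of negative eigenvalues is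
`|I₋| − 1`, where `I₊` (resp. `I₋`) collects the indices in `{0,…,n+1}` with positive
(resp. negative) coefficient.  Since `ℓ₀ = −1`, this amounts to:
`#{positive eigenvalues} + 1 = #{i : ℓᵢ > 0}` and `#{negative eigenvalues} = #{i : ℓᵢ < 0}`
(the latter counts only the sample indices `1,…,n+1`). -/
theorem stmt_9 (n : ℕ)
    (x : Fin (n + 1) → (Fin n → ℝ)) (hx : AffineIndependent ℝ x)
    (p : Fin n → ℝ) (ℓ : Fin (n + 1) → ℝ)
    (hsum : ∑ i, ℓ i = 1) (hbary : ∑ i, ℓ i • x i = p)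
    (hnz : ∀ i, ℓ i ≠ 0)
    (G : Matrix (Fin n) (Fin n) ℝ)
    (hG : G = (-1 : ℝ) • vecMulVec p p + ∑ i, ℓ i • vecMulVec (x i) (x i))
    (hGh : G.IsHermitian) :
    (Finset.univ.filter fun i : Fin n => 0 < hGh.eigenvalues i).card + 1
        = (Finset.univ.filter fun i : Fin (n + 1) => 0 < ℓ i).card ∧
    (Finset.univ.filter fun i : Fin n => hGh.eigenvalues i < 0).card
        = (Finset.univ.filter fun i : Fin (n + 1) => ℓ i < 0).card := by
  let U : Matrix (Fin n) (Fin n) ℝ := hGh.eigenvectorUnitary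
  let f : (Fin (n + 1) → ℝ) →ₗ[ℝ] (Fin (n + 1) → ℝ) :=
    { toFun := fun y i => y 0 + (x i - p) ⬝ᵥ (U *ᵥ Fin.tail y)
      map_add' := fun y z => by
        ext i
        have h : Fin.tail (y + z) = Fin.tail y + Fin.tail z := rfl
        simp only [h, mulVec_add, dotProduct_add, Pi.add_apply]
        ring
      map_smul' := fun c y => by
        ext i
        have h : Fin.tail (c • y) = c • Fin.tail y := rfl
        simp only [h, mulVec_smul, dotProduct_smul, Pi.smul_apply, smul_eq_mul, RingHom.id_apply]
        ring }
  have hf_apply (y i) : f y i = y 0 + (x i - p) ⬝ᵥ (U *ᵥ Fin.tail y) := rfl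
  have hf : Function.Injective f := by
    rw [injective_iff_map_eq_zero]
    intro y hy
    have hi (i) : y 0 + (x i - p) ⬝ᵥ (U *ᵥ Fin.tail y) = 0 := congrFun hy i
    have hU : U *ᵥ Fin.tail y = 0 := hx.eq_zero_of_dotProduct_eq
      (c := p ⬝ᵥ (U *ᵥ Fin.tail y) - y 0) fun i => by
        have := hi i
        rw [sub_dotProduct] at this
        linarith
    have h0 : y 0 = 0 := by simpa [hU] using hi 0
    have htail : Fin.tail y = 0 := by
      have h := congrArg (star U *ᵥ ·) hU
      simpa [U, mulVec_mulVec] using h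
    ext i
    refine Fin.cases h0 (fun j => congrFun htail j) i
  have hquad (y) : ∑ i, ℓ i * f y i ^ 2 =
      ∑ i, (Fin.cons 1 hGh.eigenvalues : Fin (n + 1) → ℝ) i * y i ^ 2 := by
    simp only [hf_apply]
    rw [sum_mul_add_dotProduct_sq x p ℓ hsum hbary, ← hG,
      hGh.dotProduct_mulVec_eigenvectorUnitary, Fin.sum_univ_succ]
    simp [Fin.tail]
  have key := card_pos_neg_weights_eq_of_injective _ ℓ f hf hquad
  rw [← key.1, ← key.2, Fin.card_filter_univ_succ, Fin.card_filter_univ_succ]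
  simp [not_lt.mpr zero_le_one]
end

section
/- Under the standing setup (Θ affinely independent and ordered so that ℓ₁ ≥ … ≥ ℓ_{n+1}, all ℓ_i ≠ 0, x₀ = x, ℓ₀ = −1, G = Σ_{i=0}^{n+1} ℓ_i x_i x_iᵀ, with Y₋ ∈ ℝ^{(|I₋|−1)×n} the matrix whose rows are x_i − x for the indices i ∈ I₋ \ {0}, and P₋ ∈ ℝ^{n×(|I₋|−1)} an orthonormal matrix of eigenvectors of G corresponding to its |I₋| − 1 negative eigenvalues), the square matrix Y₋ P₋ ∈ ℝ^{(|I₋|−1)×(|I₋|−1)} is invertible. -/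
open Matrix

/-- A weighted sum of squared deviations from the weighted mean. -/
theorem sum_mul_sub_sq_of_sum_eq_one {ι : Type*} (s : Finset ι) (w a : ι → ℝ) (b : ℝ)
    (hw : ∑ i ∈ s, w i = 1) (hb : ∑ i ∈ s, w i * a i = b) :
    ∑ i ∈ s, w i * (a i - b) ^ 2 = ∑ i ∈ s, w i * a i ^ 2 - b ^ 2 := by
  have h : ∀ i, w i * (a i - b) ^ 2 = w i * a i ^ 2 - 2 * b * (w i * a i) + b ^ 2 * w i :=
    fun i => by ring
  simp only [h, Finset.sum_add_distrib, Finset.sum_sub_distrib, ← Finset.mul_sum, hw, hb]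
  ring

theorem dotProduct_vecMulVec_self_mulVec {n : Type*} [Fintype n] (a u : n → ℝ) :
    u ⬝ᵥ (vecMulVec a a *ᵥ u) = (a ⬝ᵥ u) ^ 2 := by
  rw [vecMulVec_mulVec, op_smul_eq_smul, dotProduct_smul, dotProduct_comm u a, smul_eq_mul, sq]

/-- The quadratic form of a weighted scatter matrix, centered at the weighted mean. -/
theorem dotProduct_weighted_vecMulVec_mulVec {ι n : Type*} [Fintype ι] [Fintype n]
    (x : ι → n → ℝ) (p : n → ℝ) (w : ι → ℝ) (hw : ∑ i, w i = 1) (hp : ∑ i, w i • x i = p)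
    (u : n → ℝ) :
    u ⬝ᵥ (((-1 : ℝ) • vecMulVec p p + ∑ i, w i • vecMulVec (x i) (x i)) *ᵥ u) =
      ∑ i, w i * ((x i - p) ⬝ᵥ u) ^ 2 := by
  have hb : ∑ i, w i * (x i ⬝ᵥ u) = p ⬝ᵥ u := by
    simp only [← hp, sum_dotProduct, smul_dotProduct, smul_eq_mul]
  simp only [sub_dotProduct]
  rw [sum_mul_sub_sq_of_sum_eq_one _ _ _ _ hw hb]
  simp only [add_mulVec, sum_mulVec, smul_mulVec, dotProduct_add, dotProduct_sum,
    dotProduct_smul, dotProduct_vecMulVec_self_mulVec, smul_eq_mul]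
  ring

/-- Standing setup: `Θ` affinely independent, barycentric coordinates of `x` ordered
decreasingly with the first `m` positive and the rest negative, `G = Σ ℓᵢ xᵢ xᵢᵀ`
(with `x₀ = x`, `ℓ₀ = −1`), `Y₋` the matrix whose rows are `xᵢ − x` for the negative sample
indices, and `P₋` an orthonormal matrix of eigenvectors of `G` for negative eigenvalues.
Then `Y₋ P₋` is invertible. -/
theorem stmt_10 (n m : ℕ) (hm1 : 1 ≤ m) (hmn : m ≤ n + 1)
    (x : Fin (n + 1) → (Fin n → ℝ)) (hx : AffineIndependent ℝ x)
    (p : Fin n → ℝ) (ℓ : Fin (n + 1) → ℝ)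
    (hsum : ∑ i, ℓ i = 1) (hbary : ∑ i, ℓ i • x i = p)
    (hmono : ∀ i j : Fin (n + 1), i ≤ j → ℓ j ≤ ℓ i)
    (hsign : ∀ i : Fin (n + 1), if (i : ℕ) < m then 0 < ℓ i else ℓ i < 0)
    (G : Matrix (Fin n) (Fin n) ℝ)
    (hG : G = (-1 : ℝ) • vecMulVec p p + ∑ i, ℓ i • vecMulVec (x i) (x i))
    (Yminus : Matrix (Fin (n + 1 - m)) (Fin n) ℝ)
    (hY : ∀ (j : Fin (n + 1 - m)) (r : Fin n),
      Yminus j r = x ⟨m + j.1, by have := j.2; omega⟩ r - p r)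
    (Pminus : Matrix (Fin n) (Fin (n + 1 - m)) ℝ)
    (hPo : Pminusᵀ * Pminus = 1)
    (d : Fin (n + 1 - m) → ℝ) (hd : ∀ j, d j < 0)
    (hPe : G * Pminus = Pminus * Matrix.diagonal d) :
    IsUnit (Yminus * Pminus) := by
  rw [← mulVec_injective_iff_isUnit]
  refine (injective_iff_map_eq_zero (Yminus * Pminus).mulVecLin).2 fun v hv => ?_
  rw [mulVecLin_apply, ← mulVec_mulVec] at hv
  set u := Pminus *ᵥ v with hu
  have hform : u ⬝ᵥ (G *ᵥ u) = ∑ j, d j * v j ^ 2 := by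
    rw [hu, mulVec_mulVec, hPe, ← vecMul_transpose, ← dotProduct_mulVec, mulVec_mulVec,
      ← Matrix.mul_assoc, hPo, Matrix.one_mul]
    simp only [dotProduct, mulVec_diagonal]
    exact Finset.sum_congr rfl fun j _ => by ring
  have hnonneg : 0 ≤ u ⬝ᵥ (G *ᵥ u) := by
    rw [hG, dotProduct_weighted_vecMulVec_mulVec x p ℓ hsum hbary]
    refine Finset.sum_nonneg fun i _ => ?_
    have hi := hsign i
    split_ifs at hi with him
    · exact mul_nonneg hi.le (sq_nonneg _)
    · have hlt : (i : ℕ) - m < n + 1 - m := by omega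
      have hrow : (x i - p) = Yminus ⟨i - m, hlt⟩ := by
        ext r
        rw [hY, Pi.sub_apply]
        congr
        exact Fin.ext (show (i : ℕ) = m + (i - m) by omega)
      have hzero : (x i - p) ⬝ᵥ u = 0 := by
        rw [hrow]
        exact congrFun hv _
      simp [hzero]
  rw [hform] at hnonneg
  have hnonpos : ∀ j ∈ Finset.univ, d j * v j ^ 2 ≤ 0 := fun j _ =>
    mul_nonpos_of_nonpos_of_nonneg (hd j).le (sq_nonneg _)
  have hzero := (Finset.sum_eq_zero_iff_of_nonpos hnonpos).1
    (le_antisymm (Finset.sum_nonpos hnonpos) hnonneg)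
  ext j
  simpa [(hd j).ne] using hzero j (Finset.mem_univ j)
end

section
/- Under the standing setup, define M = diag(ℓ₊) Y₊ P₋ (Y₋ P₋)⁻¹ ∈ ℝ^{|I₊|×(|I₋|−1)}, let μ_{ij} be the entry of M in the row corresponding to i ∈ I₊ and the column corresponding to j ∈ I₋ \ {0}, and let μ_{i0} = ℓ_i − Σ_{j ∈ I₋\{0}} μ_{ij} for i ∈ I₊. Then Σ_{j ∈ I₋} μ_{ij} = ℓ_i for every i ∈ I₊, and Σ_{i ∈ I₊} μ_{ij} = −ℓ_j for every j ∈ I₋. -/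
open Matrix

theorem Fin.sum_eq_sum_castLE_add_sum {N m : ℕ} (h : m ≤ N) {A : Type*} [AddCommMonoid A]
    (f : Fin N → A) :
    ∑ i, f i = ∑ i : Fin m, f (Fin.castLE h i) +
      ∑ j : Fin (N - m), f ⟨m + j.1, by have := j.2; omega⟩ := by
  obtain ⟨k, rfl⟩ := Nat.exists_eq_add_of_le h
  rw [Fin.sum_univ_add]
  congr 1
  refine Fintype.sum_equiv (finCongr (by omega)) _ _ fun j => ?_
  congr 1

/-- If the columns of `P` are orthonormal eigenvectors of `G` for negative eigenvalues and the
quadratic form of `G` is nonnegative on the kernel of `Y`, then `Y * P` is invertible. -/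
theorem Matrix.isUnit_det_mul_of_quadraticForm_neg {ι κ : Type*} [Fintype ι] [Fintype κ]
    [DecidableEq κ] (G : Matrix ι ι ℝ) (P : Matrix ι κ ℝ) (Y : Matrix κ ι ℝ) (d : κ → ℝ)
    (hPo : Pᵀ * P = 1) (hd : ∀ j, d j < 0) (hPe : G * P = P * diagonal d)
    (hG : ∀ w, Y *ᵥ w = 0 → 0 ≤ w ⬝ᵥ G *ᵥ w) : IsUnit (Y * P).det := by
  rw [isUnit_iff_ne_zero]
  intro h0
  obtain ⟨v, hv, hv0⟩ := exists_mulVec_eq_zero_iff.mpr h0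
  rw [← mulVec_mulVec] at hv0
  have hq := hG _ hv0
  have key : P *ᵥ v ⬝ᵥ G *ᵥ (P *ᵥ v) = ∑ j, d j * v j ^ 2 := by
    rw [mulVec_mulVec, hPe, dotProduct_mulVec, ← vecMul_vecMul, ← vecMul_transpose,
      vecMul_vecMul v, hPo, vecMul_one, ← dotProduct_mulVec]
    simp only [dotProduct, mulVec_diagonal]
    exact Finset.sum_congr rfl fun j _ => by ring
  obtain ⟨k, hk⟩ := Function.ne_iff.mp hv
  have : ∑ j, d j * v j ^ 2 < 0 :=
    Finset.sum_neg' (fun j _ => mul_nonpos_of_nonpos_of_nonneg (hd j).le (sq_nonneg _))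
      ⟨k, Finset.mem_univ _, mul_neg_of_neg_of_pos (hd k) (by have : v k ≠ 0 := hk; positivity)⟩
  linarith

/-- If the weights `ℓ` sum to one and `p` is the weighted mean of the `x i`, the quadratic form of
the weighted second-moment matrix centred at `p` is a weighted sum of squares. -/
theorem Matrix.dotProduct_centered_moment_mulVec {ι κ : Type*} [Fintype ι] [Fintype κ]
    (x : κ → ι → ℝ) (p : ι → ℝ) (ℓ : κ → ℝ) (hsum : ∑ i, ℓ i = 1) (hbary : ∑ i, ℓ i • x i = p)
    (w : ι → ℝ) :
    w ⬝ᵥ ((-1 : ℝ) • vecMulVec p p + ∑ i, ℓ i • vecMulVec (x i) (x i)) *ᵥ w =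
      ∑ i, ℓ i * ((x i - p) ⬝ᵥ w) ^ 2 := by
  have hp : ∑ i, ℓ i * (x i ⬝ᵥ w) = p ⬝ᵥ w := by
    rw [← hbary, sum_dotProduct]
    simp
  have hL : w ⬝ᵥ ((-1 : ℝ) • vecMulVec p p + ∑ i, ℓ i • vecMulVec (x i) (x i)) *ᵥ w =
      -(p ⬝ᵥ w) ^ 2 + ∑ i, ℓ i * (x i ⬝ᵥ w) ^ 2 := by
    simp only [add_mulVec, sum_mulVec, smul_mulVec, vecMulVec_mulVec, op_smul_eq_smul,
      dotProduct_comm w, add_dotProduct, sum_dotProduct, smul_dotProduct, smul_eq_mul]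
    congr 1
    · ring
    · exact Finset.sum_congr rfl fun i _ => by ring
  have hR : ∑ i, ℓ i * ((x i - p) ⬝ᵥ w) ^ 2 = ∑ i, ℓ i * (x i ⬝ᵥ w) ^ 2
      - 2 * (p ⬝ᵥ w) * ∑ i, ℓ i * (x i ⬝ᵥ w) + (p ⬝ᵥ w) ^ 2 * ∑ i, ℓ i := by
    rw [Finset.mul_sum, Finset.mul_sum, ← Finset.sum_sub_distrib, ← Finset.sum_add_distrib]
    exact Finset.sum_congr rfl fun i _ => by rw [sub_dotProduct]; ring
  rw [hL, hR, hp, hsum]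
  ring

/-- Standing setup plus `M = diag(ℓ₊) Y₊ P₋ (Y₋ P₋)⁻¹` with entries `μ_{ij}`
(for `i ∈ I₊`, `j ∈ I₋ \ {0}`) and `μ_{i0} = ℓ_i − Σ_{j ∈ I₋\{0}} μ_{ij}`.
Then `Σ_{j ∈ I₋} μ_{ij} = ℓ_i` for every `i ∈ I₊`, and `Σ_{i ∈ I₊} μ_{ij} = −ℓ_j`
for every `j ∈ I₋` (recall `ℓ₀ = −1`, so for `j = 0` the sum is `1`). -/
theorem stmt_11 (n m : ℕ) (hm1 : 1 ≤ m) (hmn : m ≤ n + 1)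
    (x : Fin (n + 1) → (Fin n → ℝ)) (hx : AffineIndependent ℝ x)
    (p : Fin n → ℝ) (ℓ : Fin (n + 1) → ℝ)
    (hsum : ∑ i, ℓ i = 1) (hbary : ∑ i, ℓ i • x i = p)
    (hmono : ∀ i j : Fin (n + 1), i ≤ j → ℓ j ≤ ℓ i)
    (hsign : ∀ i : Fin (n + 1), if (i : ℕ) < m then 0 < ℓ i else ℓ i < 0)
    (G : Matrix (Fin n) (Fin n) ℝ)
    (hG : G = (-1 : ℝ) • vecMulVec p p + ∑ i, ℓ i • vecMulVec (x i) (x i))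
    (Yplus : Matrix (Fin m) (Fin n) ℝ)
    (hYp : ∀ (i : Fin m) (r : Fin n), Yplus i r = x (Fin.castLE hmn i) r - p r)
    (Yminus : Matrix (Fin (n + 1 - m)) (Fin n) ℝ)
    (hYm : ∀ (j : Fin (n + 1 - m)) (r : Fin n),
      Yminus j r = x ⟨m + j.1, by have := j.2; omega⟩ r - p r)
    (Pminus : Matrix (Fin n) (Fin (n + 1 - m)) ℝ)
    (hPo : Pminusᵀ * Pminus = 1)
    (d : Fin (n + 1 - m) → ℝ) (hd : ∀ j, d j < 0)
    (hPe : G * Pminus = Pminus * Matrix.diagonal d)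
    (M : Matrix (Fin m) (Fin (n + 1 - m)) ℝ)
    (hM : M = Matrix.diagonal (fun i : Fin m => ℓ (Fin.castLE hmn i))
        * Yplus * Pminus * (Yminus * Pminus)⁻¹)
    (μ0 : Fin m → ℝ)
    (hμ0 : ∀ i, μ0 i = ℓ (Fin.castLE hmn i) - ∑ j, M i j) :
    (∀ i : Fin m, μ0 i + ∑ j, M i j = ℓ (Fin.castLE hmn i)) ∧
    (∀ j : Fin (n + 1 - m), ∑ i, M i j = -ℓ ⟨m + j.1, by have := j.2; omega⟩) ∧
    (∑ i, μ0 i = 1) := by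
  have hdet : IsUnit (Yminus * Pminus).det := by
    refine isUnit_det_mul_of_quadraticForm_neg G Pminus Yminus d hPo hd hPe fun w hw => ?_
    rw [hG, dotProduct_centered_moment_mulVec x p ℓ hsum hbary]
    refine Finset.sum_nonneg fun i _ => ?_
    have hs := hsign i
    split_ifs at hs with hi
    · positivity
    · have hrow := congrFun hw ⟨i - m, by omega⟩
      have hx_eq : Yminus ⟨i - m, by omega⟩ = x i - p := by
        funext r
        rw [hYm]
        simp [Nat.add_sub_cancel' (not_lt.mp hi)]
      rw [mulVec, hx_eq, Pi.zero_apply] at hrow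
      simp [hrow]
  have hbal : (fun i : Fin m => ℓ (Fin.castLE hmn i)) ᵥ* Yplus =
      -((fun j : Fin (n + 1 - m) => ℓ ⟨m + j.1, by have := j.2; omega⟩) ᵥ* Yminus) := by
    funext r
    have h0 : ∑ i, ℓ i * (x i r - p r) = 0 := by
      simp only [mul_sub, Finset.sum_sub_distrib, ← Finset.sum_mul, hsum]
      rw [← hbary]
      simp
    rw [Fin.sum_eq_sum_castLE_add_sum hmn] at h0
    simp only [vecMul, dotProduct, Pi.neg_apply, hYp, hYm]
    linarith
  have hcol : ∀ j : Fin (n + 1 - m),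
      ∑ i, M i j = -ℓ ⟨m + j.1, by have := j.2; omega⟩ := by
    have hone : (1 : Fin m → ℝ) ᵥ* diagonal (fun i : Fin m => ℓ (Fin.castLE hmn i)) =
        fun i => ℓ (Fin.castLE hmn i) := by
      funext i
      simp [vecMul_diagonal]
    have hv : (1 : Fin m → ℝ) ᵥ* M =
        -(fun j : Fin (n + 1 - m) => ℓ ⟨m + j.1, by have := j.2; omega⟩) := by
      rw [hM, ← vecMul_vecMul, ← vecMul_vecMul, ← vecMul_vecMul, hone, hbal, neg_vecMul,
        neg_vecMul, vecMul_vecMul _ Yminus, vecMul_vecMul, mul_nonsing_inv _ hdet, vecMul_one]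
    intro j
    simpa [vecMul, dotProduct] using congrFun hv j
  refine ⟨fun i => by rw [hμ0]; ring, hcol, ?_⟩
  have hM_sum : ∑ i, ∑ j, M i j =
      -∑ j : Fin (n + 1 - m), ℓ ⟨m + j.1, by have := j.2; omega⟩ := by
    refine Finset.sum_comm.trans ?_
    rw [← Finset.sum_neg_distrib]
    exact Finset.sum_congr rfl fun j _ => hcol j
  simp only [hμ0, Finset.sum_sub_distrib]
  rw [hM_sum, sub_neg_eq_add, ← Fin.sum_eq_sum_castLE_add_sum hmn, hsum]
end

section
/- Under the standing setup, define M = diag(ℓ₊) Y₊ P₋ (Y₋ P₋)⁻¹, μ_{ij} its entries for i ∈ I₊ and j ∈ I₋ \ {0}, μ_{i0} = ℓ_i − Σ_{j ∈ I₋\{0}} μ_{ij}, and H* = ν(P₊P₊ᵀ − P₋P₋ᵀ) for ν > 0. Then for every i ∈ I₊: (νI − H*) Σ_{j ∈ I₋} μ_{ij} x_j = (νI − H*) ℓ_i x_i, and for every j ∈ I₋: (νI + H*) Σ_{i ∈ I₊} μ_{ij} x_i = −(νI + H*) ℓ_j x_j. -/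
open Matrix

lemma Fin.sum_castLE_add_sum_offset {E : Type*} [AddCommMonoid E] {n m : ℕ} (hmn : m ≤ n)
    (f : Fin n → E) :
    ∑ i, f i = ∑ i : Fin m, f (Fin.castLE hmn i)
      + ∑ j : Fin (n - m), f ⟨m + j.1, by have := j.2; omega⟩ := by
  obtain ⟨k, rfl⟩ := Nat.exists_eq_add_of_le hmn
  rw [Fin.sum_univ_add]
  congr 1
  exact Fintype.sum_equiv (finCongr (by omega)) _ _ fun j => rfl

section

variable {ι α β κ : Type*} [Fintype ι] [Fintype α] [Fintype β] [Fintype κ]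
  [DecidableEq β]

lemma Matrix.mul_transpose_add_mul_transpose_eq_one
    [DecidableEq ι] [DecidableEq κ] (P : Matrix ι κ ℝ) (Q : Matrix ι β ℝ)
    (hcard : Fintype.card κ + Fintype.card β = Fintype.card ι)
    (hP : Pᵀ * P = 1) (hQ : Qᵀ * Q = 1) (hPQ : Pᵀ * Q = 0) :
    P * Pᵀ + Q * Qᵀ = 1 := by
  have hQP : Qᵀ * P = 0 := by
    simpa [transpose_mul] using congrArg transpose hPQ
  have h : fromRows Pᵀ Qᵀ * fromCols P Q = 1 := by
    rw [fromRows_mul_fromCols, hP, hQ, hPQ, hQP, fromBlocks_one]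
  have h' := (mul_eq_one_comm_of_card_eq (κ ⊕ β) ι ℝ (by simpa using hcard)).1 h
  rwa [fromCols_mul_fromRows] at h'

/-- A form that is positive semidefinite on the kernel of `B` and negative definite on the range
of `Q` forces `B * Q` to be injective. -/
lemma Matrix.isUnit_det_mul_of_congr_eq_diagonal_neg [DecidableEq α]
    (A : Matrix α ι ℝ) (B : Matrix β ι ℝ)
    (Q : Matrix ι β ℝ) (a : α → ℝ) (b d : β → ℝ) (ha : ∀ i, 0 ≤ a i) (hd : ∀ j, d j < 0)
    (h : Qᵀ * (Aᵀ * diagonal a * A + Bᵀ * diagonal b * B) * Q = diagonal d) :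
    IsUnit (B * Q).det := by
  rw [isUnit_iff_ne_zero]
  intro hdet
  obtain ⟨v, hv, hBQ⟩ := exists_mulVec_eq_zero_iff.2 hdet
  have hform : v ⬝ᵥ (diagonal d *ᵥ v) = (A *ᵥ Q *ᵥ v) ⬝ᵥ (diagonal a *ᵥ A *ᵥ Q *ᵥ v) := by
    rw [← h]
    simp only [Matrix.mul_add, Matrix.add_mul, Matrix.mul_assoc, add_mulVec]
    simp only [← mulVec_mulVec] at hBQ ⊢
    simp only [hBQ, mulVec_zero, add_zero]
    rw [dotProduct_mulVec, vecMul_transpose, dotProduct_mulVec, vecMul_transpose]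
  have hpos : 0 ≤ v ⬝ᵥ (diagonal d *ᵥ v) := by
    rw [hform]
    simp only [dotProduct, mulVec_diagonal]
    exact Finset.sum_nonneg fun i _ => by
      nlinarith [mul_nonneg (ha i) (mul_self_nonneg ((A *ᵥ Q *ᵥ v) i))]
  obtain ⟨j, hj⟩ := Function.ne_iff.1 hv
  have hneg : v ⬝ᵥ (diagonal d *ᵥ v) < 0 := by
    simp only [dotProduct, mulVec_diagonal]
    refine Finset.sum_neg' (fun i _ => ?_) ⟨j, Finset.mem_univ j, ?_⟩
    · nlinarith [mul_nonneg (neg_nonneg.2 (hd i).le) (mul_self_nonneg (v i))]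
    · nlinarith [mul_pos (neg_pos.2 (hd j)) (mul_self_pos.2 hj)]
  exact hneg.not_ge hpos

end

/-- Standing setup with the full eigendecomposition `G = P₊Λ₊P₊ᵀ + P₋Λ₋P₋ᵀ` and
`H* = ν(P₊P₊ᵀ − P₋P₋ᵀ)`.  Then `(νI − H*) Σ_{j∈I₋} μ_{ij} x_j = (νI − H*) ℓ_i x_i` for
`i ∈ I₊`, and `(νI + H*) Σ_{i∈I₊} μ_{ij} x_i = −(νI + H*) ℓ_j x_j` for `j ∈ I₋`
(the last conjunct is the case `j = 0`, where `x₀ = x` and `ℓ₀ = −1`). -/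
theorem stmt_12 (n m : ℕ) (hm1 : 1 ≤ m) (hmn : m ≤ n + 1) (ν : ℝ) (hν : 0 < ν)
    (x : Fin (n + 1) → (Fin n → ℝ)) (hx : AffineIndependent ℝ x)
    (p : Fin n → ℝ) (ℓ : Fin (n + 1) → ℝ)
    (hsum : ∑ i, ℓ i = 1) (hbary : ∑ i, ℓ i • x i = p)
    (hmono : ∀ i j : Fin (n + 1), i ≤ j → ℓ j ≤ ℓ i)
    (hsign : ∀ i : Fin (n + 1), if (i : ℕ) < m then 0 < ℓ i else ℓ i < 0)
    (G : Matrix (Fin n) (Fin n) ℝ)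
    (hG : G = (-1 : ℝ) • vecMulVec p p + ∑ i, ℓ i • vecMulVec (x i) (x i))
    (Yplus : Matrix (Fin m) (Fin n) ℝ)
    (hYp : ∀ (i : Fin m) (r : Fin n), Yplus i r = x (Fin.castLE hmn i) r - p r)
    (Yminus : Matrix (Fin (n + 1 - m)) (Fin n) ℝ)
    (hYm : ∀ (j : Fin (n + 1 - m)) (r : Fin n),
      Yminus j r = x ⟨m + j.1, by have := j.2; omega⟩ r - p r)
    (Pplus : Matrix (Fin n) (Fin (m - 1)) ℝ)
    (Pminus : Matrix (Fin n) (Fin (n + 1 - m)) ℝ)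
    (hPpo : Pplusᵀ * Pplus = 1)
    (hPmo : Pminusᵀ * Pminus = 1)
    (hPpm : Pplusᵀ * Pminus = 0)
    (dplus : Fin (m - 1) → ℝ) (hdp : ∀ i, 0 < dplus i)
    (dminus : Fin (n + 1 - m) → ℝ) (hdm : ∀ j, dminus j < 0)
    (hdecomp : G = Pplus * Matrix.diagonal dplus * Pplusᵀ
        + Pminus * Matrix.diagonal dminus * Pminusᵀ)
    (M : Matrix (Fin m) (Fin (n + 1 - m)) ℝ)
    (hM : M = Matrix.diagonal (fun i : Fin m => ℓ (Fin.castLE hmn i))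
        * Yplus * Pminus * (Yminus * Pminus)⁻¹)
    (μ0 : Fin m → ℝ)
    (hμ0 : ∀ i, μ0 i = ℓ (Fin.castLE hmn i) - ∑ j, M i j)
    (Hstar : Matrix (Fin n) (Fin n) ℝ)
    (hHstar : Hstar = ν • (Pplus * Pplusᵀ - Pminus * Pminusᵀ)) :
    (∀ i : Fin m,
      (ν • (1 : Matrix (Fin n) (Fin n) ℝ) - Hstar).mulVec
          (μ0 i • p + ∑ j : Fin (n + 1 - m), M i j • x ⟨m + j.1, by have := j.2; omega⟩)
        = (ν • (1 : Matrix (Fin n) (Fin n) ℝ) - Hstar).mulVec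
            (ℓ (Fin.castLE hmn i) • x (Fin.castLE hmn i))) ∧
    (∀ j : Fin (n + 1 - m),
      (ν • (1 : Matrix (Fin n) (Fin n) ℝ) + Hstar).mulVec
          (∑ i : Fin m, M i j • x (Fin.castLE hmn i))
        = -(ν • (1 : Matrix (Fin n) (Fin n) ℝ) + Hstar).mulVec
            ((ℓ ⟨m + j.1, by have := j.2; omega⟩) • x ⟨m + j.1, by have := j.2; omega⟩)) ∧
    ((ν • (1 : Matrix (Fin n) (Fin n) ℝ) + Hstar).mulVec
        (∑ i : Fin m, μ0 i • x (Fin.castLE hmn i))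
      = -(ν • (1 : Matrix (Fin n) (Fin n) ℝ) + Hstar).mulVec ((-1 : ℝ) • p)) := by
  have hm : ∀ i : Fin m, 0 < ℓ (Fin.castLE hmn i) := fun i => by
    simpa [i.2] using hsign (Fin.castLE hmn i)
  have hsplit := fun f : Fin (n + 1) → ℝ => Fin.sum_castLE_add_sum_offset hmn f
  set a : Fin m → ℝ := fun i => ℓ (Fin.castLE hmn i) with ha
  set b : Fin (n + 1 - m) → ℝ := fun j => ℓ ⟨m + j.1, by have := j.2; omega⟩ with hb
  have hbr : ∀ r, ∑ i, ℓ i * x i r = p r := fun r => by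
    simpa using congrFun hbary r
  have hGY : G = Yplusᵀ * diagonal a * Yplus + Yminusᵀ * diagonal b * Yminus := by
    ext r s
    have hcentered : G r s = ∑ i, ℓ i * ((x i r - p r) * (x i s - p s)) := by
      have hexpand : ∀ i, ℓ i * ((x i r - p r) * (x i s - p s)) =
          ℓ i * (x i r * x i s) - ℓ i * x i r * p s - ℓ i * x i s * p r
            + ℓ i * (p r * p s) := fun i => by ring
      simp only [hexpand, Finset.sum_add_distrib, Finset.sum_sub_distrib, ← Finset.sum_mul,
        hsum, hbr]
      simp [hG, Matrix.sum_apply, vecMulVec_apply]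
      ring
    rw [hcentered, hsplit]
    rw [Matrix.add_apply, Matrix.mul_apply, Matrix.mul_apply]
    simp only [mul_diagonal, transpose_apply, hYp, hYm, ha, hb]
    congr 1 <;> exact Finset.sum_congr rfl fun i _ => by ring
  have hone := mul_transpose_add_mul_transpose_eq_one Pplus Pminus (by simp; omega)
    hPpo hPmo hPpm
  have hPmp : Pminusᵀ * Pplus = 0 := by
    simpa [transpose_mul] using congrArg transpose hPpm
  have hunit : IsUnit (Yminus * Pminus).det := by
    refine isUnit_det_mul_of_congr_eq_diagonal_neg Yplus Yminus Pminus a b dminus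
      (fun i => (hm i).le) hdm ?_
    rw [← hGY, hdecomp]
    simp only [Matrix.mul_add, Matrix.add_mul, ← Matrix.mul_assoc, hPmp, hPmo]
    simp [Matrix.mul_assoc, hPmo]
  have hMY : M * (Yminus * Pminus) = diagonal a * Yplus * Pminus := by
    rw [hM, Matrix.mul_assoc, nonsing_inv_mul _ hunit, Matrix.mul_one]
  have hrow : (M * Yminus - diagonal a * Yplus) * Pminus = 0 := by
    rw [Matrix.sub_mul, Matrix.mul_assoc, hMY, sub_self]
  have hcol : (Mᵀ * Yplus + diagonal b * Yminus) * Pplus = 0 := by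
    have hT : (Yminus * Pminus)ᵀ * Mᵀ = Pminusᵀ * Yplusᵀ * diagonal a := by
      rw [← transpose_mul, hMY]
      simp [transpose_mul, Matrix.mul_assoc]
    have hzero : (Yminus * Pminus)ᵀ * ((Mᵀ * Yplus + diagonal b * Yminus) * Pplus) = 0 := by
      calc _ = (Yminus * Pminus)ᵀ * Mᵀ * Yplus * Pplus
            + Pminusᵀ * Yminusᵀ * diagonal b * Yminus * Pplus := by
            simp [transpose_mul, Matrix.mul_assoc, Matrix.mul_add, Matrix.add_mul]
        _ = Pminusᵀ * G * Pplus := by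
            rw [hT, hGY]
            simp [Matrix.mul_assoc, Matrix.mul_add, Matrix.add_mul]
        _ = 0 := by
            rw [hdecomp]
            simp only [Matrix.mul_add, Matrix.add_mul, ← Matrix.mul_assoc, hPmp]
            simp [Matrix.mul_assoc, hPmp]
    have hunitT : IsUnit ((Yminus * Pminus)ᵀ).det := by rwa [det_transpose]
    rw [← nonsing_inv_mul_cancel_left _ ((Mᵀ * Yplus + diagonal b * Yminus) * Pplus) hunitT, hzero,
      Matrix.mul_zero]
  have hbal : a ᵥ* Yplus = -(b ᵥ* Yminus) := by
    ext r
    have hr : ∑ i, ℓ i * (x i r - p r) = 0 := by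
      simp only [mul_sub, Finset.sum_sub_distrib, ← Finset.sum_mul, hsum, hbr]
      ring
    rw [hsplit] at hr
    simp only [vecMul, dotProduct, Pi.neg_apply, hYp, hYm, ha, hb]
    linarith
  have hcolsum : ∀ j, ∑ i, M i j = -b j := fun j => by
    have h1 : (1 : Fin m → ℝ) ᵥ* M = -b := by
      have hMa : (1 : Fin m → ℝ) ᵥ* M = a ᵥ* Yplus ᵥ* Pminus ᵥ* (Yminus * Pminus)⁻¹ := by
        have h1a : (1 : Fin m → ℝ) ᵥ* diagonal a = a := by ext i; simp [vecMul_diagonal]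
        rw [hM]
        simp only [← vecMul_vecMul]
        rw [h1a]
      rw [hMa, hbal, neg_vecMul, neg_vecMul, vecMul_vecMul b,
        vecMul_vecMul,
        mul_nonsing_inv _ hunit, vecMul_one]
    simpa [vecMul, dotProduct] using congrFun h1 j
  have hminus : ν • (1 : Matrix (Fin n) (Fin n) ℝ) - Hstar = (2 * ν) • (Pminus * Pminusᵀ) := by
    rw [hHstar, ← hone]
    module
  have hplus : ν • (1 : Matrix (Fin n) (Fin n) ℝ) + Hstar = (2 * ν) • (Pplus * Pplusᵀ) := by
    rw [hHstar, ← hone]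
    module
  have hcolzero : ∀ j : Fin (n + 1 - m), (ν • (1 : Matrix (Fin n) (Fin n) ℝ) + Hstar) *ᵥ
      (∑ i : Fin m, M i j • x (Fin.castLE hmn i)
        + ℓ ⟨m + j.1, by have := j.2; omega⟩ • x ⟨m + j.1, by have := j.2; omega⟩) = 0 := by
    intro j
    have hvec : ∑ i : Fin m, M i j • x (Fin.castLE hmn i)
        + ℓ ⟨m + j.1, by have := j.2; omega⟩ • x ⟨m + j.1, by have := j.2; omega⟩
        = (Mᵀ * Yplus + diagonal b * Yminus) j := by
      ext r
      have hc := hcolsum j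
      rw [Matrix.add_apply, diagonal_mul]
      simp only [Matrix.mul_apply, transpose_apply, hYp, hYm,
        mul_sub, Finset.sum_sub_distrib, ← Finset.sum_mul, hc, Pi.add_apply, Finset.sum_apply,
        Pi.smul_apply, smul_eq_mul, hb]
      ring
    have hker : Pplusᵀ *ᵥ (Mᵀ * Yplus + diagonal b * Yminus) j = 0 := by
      rw [mulVec_transpose, ← mul_apply_eq_vecMul, hcol]
      rfl
    rw [hvec, hplus, smul_mulVec, ← mulVec_mulVec, hker, mulVec_zero, smul_zero]
  refine ⟨fun i => ?_, fun j => ?_, ?_⟩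
  · rw [← sub_eq_zero, ← mulVec_sub]
    have hvec : μ0 i • p + ∑ j : Fin (n + 1 - m), M i j • x ⟨m + j.1, by have := j.2; omega⟩
        - ℓ (Fin.castLE hmn i) • x (Fin.castLE hmn i)
        = (M * Yminus - diagonal a * Yplus) i := by
      ext r
      rw [Matrix.sub_apply, diagonal_mul]
      simp only [Matrix.mul_apply, hYp, hYm, hμ0,
        mul_sub, Finset.sum_sub_distrib, ← Finset.sum_mul, Pi.add_apply, Finset.sum_apply,
        Pi.smul_apply, Pi.sub_apply, smul_eq_mul, ha]
      ring
    have hker : Pminusᵀ *ᵥ (M * Yminus - diagonal a * Yplus) i = 0 := by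
      rw [mulVec_transpose, ← mul_apply_eq_vecMul, hrow]
      rfl
    rw [hvec, hminus, smul_mulVec, ← mulVec_mulVec, hker, mulVec_zero, smul_zero]
  · have h := hcolzero j
    rw [mulVec_add] at h
    simpa only [neg_mulVec] using eq_neg_of_add_eq_zero_left h
  · have hvec : ∑ i : Fin m, μ0 i • x (Fin.castLE hmn i) = p
        - ∑ j : Fin (n + 1 - m), (∑ i : Fin m, M i j • x (Fin.castLE hmn i)
          + ℓ ⟨m + j.1, by have := j.2; omega⟩ • x ⟨m + j.1, by have := j.2; omega⟩) := by
      have hp := hbary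
      rw [Fin.sum_castLE_add_sum_offset hmn] at hp
      simp only [hμ0, sub_smul, Finset.sum_smul, Finset.sum_sub_distrib, Finset.sum_add_distrib]
      rw [← hp, Finset.sum_comm]
      abel
    rw [hvec, mulVec_sub, mulVec_sum, Finset.sum_eq_zero fun j _ => hcolzero j]
    simp [mulVec_neg]
end

section
/- Assume f ∈ C¹,¹_ν(ℝⁿ). Let f̂ be the affine function interpolating f on an affinely independent set Θ = {x₁,…,x_{n+1}} ⊂ ℝⁿ, ordered so that the barycentric coordinates of x ∈ ℝⁿ satisfy ℓ₁ ≥ … ≥ ℓ_{n+1} with all ℓ_i ≠ 0, set x₀ = x, ℓ₀ = −1, and let G = Σ_{i=0}^{n+1} ℓ_i x_i x_iᵀ with eigenvalues λ₁,…,λ_n. Let μ_{ij} for (i,j) ∈ I₊ × I₋ be defined via M = diag(ℓ₊) Y₊ P₋ (Y₋ P₋)⁻¹ (entries μ_{ij} for j ∈ I₋ \ {0}) and μ_{i0} = ℓ_i − Σ_{j ∈ I₋\{0}} μ_{ij}. If μ_{ij} ≥ 0 for all (i,j) ∈ I₊ × I₋, then |f̂(x) − f(x)| ≤ (ν/2)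 Σ_{i=1}^{n} |λ_i|. -/
open Matrix
open scoped InnerProductSpace

/-- The quadratic Taylor bound for a function with Lipschitz gradient. -/
theorem sub_sub_inner_gradient_le {V : Type*} [NormedAddCommGroup V] [InnerProductSpace ℝ V]
    [CompleteSpace V] {ν : ℝ} {f : V → ℝ} (hdiff : Differentiable ℝ f)
    (hlip : ∀ u v, ‖gradient f u - gradient f v‖ ≤ ν * ‖u - v‖) (u v : V) :
    |f u - f v - ⟪gradient f v, u - v⟫_ℝ| ≤ ν / 2 * ‖u - v‖ ^ 2 := by
  set d := u - v with hd
  have hf : ∀ t : ℝ, HasDerivAt (fun t : ℝ => f (v + t • d) - t * ⟪gradient f v, d⟫_ℝ)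
      (⟪gradient f (v + t • d) - gradient f v, d⟫_ℝ) t := by
    intro t
    have h₁ : HasDerivAt (fun t : ℝ => v + t • d) d t := by
      simpa using ((hasDerivAt_id t).smul_const d).const_add v
    have h₂ := (hdiff (v + t • d)).hasGradientAt.hasFDerivAt.comp_hasDerivAt t h₁
    have h₃ := h₂.sub ((hasDerivAt_id t).mul_const ⟪gradient f v, d⟫_ℝ)
    simpa [inner_sub_left, Function.comp_def, Pi.sub_def] using h₃
  have hB : ∀ t : ℝ, HasDerivAt (fun t : ℝ => ν / 2 * ‖d‖ ^ 2 * t ^ 2) (ν * ‖d‖ ^ 2 * t) t := by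
    intro t
    refine ((hasDerivAt_pow 2 t).const_mul (ν / 2 * ‖d‖ ^ 2)).congr_deriv ?_
    push_cast
    ring
  have key := image_norm_le_of_norm_deriv_right_le_deriv_boundary
    (f := fun t : ℝ => f (v + t • d) - t * ⟪gradient f v, d⟫_ℝ - f v) (a := 0) (b := 1)
    (f' := fun t => ⟪gradient f (v + t • d) - gradient f v, d⟫_ℝ)
    (fun t _ => ((hf t).sub_const _).continuousAt.continuousWithinAt)
    (fun t _ => ((hf t).sub_const _).hasDerivWithinAt) (by simp) hB
    (fun t ht => by
      have h := hlip (v + t • d) v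
      rw [add_sub_cancel_left, norm_smul, Real.norm_of_nonneg ht.1] at h
      calc _ ≤ ‖gradient f (v + t • d) - gradient f v‖ * ‖d‖ := norm_inner_le_norm _ _
        _ ≤ ν * (t * ‖d‖) * ‖d‖ := by gcongr
        _ = _ := by ring)
    (Set.right_mem_Icc.2 zero_le_one)
  have hu : v + d = u := by simp [hd]
  simp only [one_smul, one_mul, one_pow, mul_one, hu, Real.norm_eq_abs] at key
  rwa [sub_right_comm] at key

/-- Nonnegative weights `w` on the pairs of points `a i`, `b j` whose weighted
displacements sum to zero along the
range of a projection `Q` for each `i`, and along its kernel for each `j`, bound the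
differences of a function by those of the quadratic form of `1 - 2 * Q`. -/
theorem sum_mul_sub_le_of_projection {V ι κ : Type*} [NormedAddCommGroup V]
    [InnerProductSpace ℝ V] [Fintype ι] [Fintype κ] {ν : ℝ} {f : V → ℝ} {g : V → V}
    (hf : ∀ u v, |f u - f v - ⟪g v, u - v⟫_ℝ| ≤ ν / 2 * ‖u - v‖ ^ 2)
    (Q : V →ₗ[ℝ] V) (hQs : ∀ u v, ⟪Q u, v⟫_ℝ = ⟪u, Q v⟫_ℝ) (hQi : ∀ u, Q (Q u) = Q u)
    (a : ι → V) (b : κ → V) (w : ι → κ → ℝ) (hw : ∀ i j, 0 ≤ w i j)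
    (ha : ∀ i, ∑ j, w i j • Q (a i - b j) = 0)
    (hb : ∀ j, ∑ i, w i j • (a i - b j - Q (a i - b j)) = 0) :
    ∑ i, ∑ j, w i j * (f (a i) - f (b j)) ≤
      ν / 2 * ∑ i, ∑ j, w i j *
        (⟪a i - (2 : ℝ) • Q (a i), a i⟫_ℝ - ⟪b j - (2 : ℝ) • Q (b j), b j⟫_ℝ) := by
  have pair : ∀ u v, f u - f v ≤ ⟪g v - ν • v, u - v - Q (u - v)⟫_ℝ + ⟪g u + ν • u, Q (u - v)⟫_ℝ
      + ν / 2 * (⟪u - (2 : ℝ) • Q u, u⟫_ℝ - ⟪v - (2 : ℝ) • Q v, v⟫_ℝ) := by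
    intro u v
    have h₁ := (abs_le.1 (hf (u - Q (u - v)) u)).1
    have h₂ := (abs_le.1 (hf (u - Q (u - v)) v)).2
    have e₁ : u - Q (u - v) - u = - Q (u - v) := by abel
    have e₂ : u - Q (u - v) - v = u - v - Q (u - v) := by abel
    rw [e₁, ← real_inner_self_eq_norm_sq] at h₁
    rw [e₂, ← real_inner_self_eq_norm_sq] at h₂
    have hvQu : ⟪v, Q u⟫_ℝ = ⟪u, Q v⟫_ℝ := by rw [real_inner_comm, hQs]
    simp only [map_sub, inner_sub_left, inner_sub_right, inner_add_left, inner_neg_left,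
      inner_neg_right, real_inner_smul_left, hQs, hQi, hvQu, real_inner_comm u v] at h₁ h₂ ⊢
    linarith
  have h₁ : ∑ i, ∑ j, w i j * ⟪g (b j) - ν • b j, a i - b j - Q (a i - b j)⟫_ℝ = 0 := by
    rw [Finset.sum_comm]
    refine Finset.sum_eq_zero fun j _ => ?_
    simp only [← real_inner_smul_right, ← inner_sum, hb, inner_zero_right]
  have h₂ : ∑ i, ∑ j, w i j * ⟪g (a i) + ν • a i, Q (a i - b j)⟫_ℝ = 0 := by
    refine Finset.sum_eq_zero fun i _ => ?_
    simp only [← real_inner_smul_right, ← inner_sum, ha, inner_zero_right]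
  calc _ ≤ ∑ i, ∑ j, w i j * (⟪g (b j) - ν • b j, a i - b j - Q (a i - b j)⟫_ℝ
        + ⟪g (a i) + ν • a i, Q (a i - b j)⟫_ℝ + ν / 2 * (⟪a i - (2 : ℝ) • Q (a i), a i⟫_ℝ
          - ⟪b j - (2 : ℝ) • Q (b j), b j⟫_ℝ)) :=
        Finset.sum_le_sum fun i _ => Finset.sum_le_sum fun j _ =>
          mul_le_mul_of_nonneg_left (pair _ _) (hw i j)
    _ = _ := by
      simp only [mul_add, Finset.sum_add_distrib, h₁, h₂, Finset.mul_sum, zero_add]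
      exact Finset.sum_congr rfl fun i _ => Finset.sum_congr rfl fun j _ => by ring

/-- Von Neumann's trace inequality against a unitary factor. -/
theorem Matrix.IsHermitian.trace_unitary_mul_le {ι : Type*} [Fintype ι] [DecidableEq ι]
    {A U : Matrix ι ι ℝ} (hA : A.IsHermitian) (hU : U ∈ unitaryGroup ι ℝ) :
    (U * A).trace ≤ ∑ i, |hA.eigenvalues i| := by
  set W := hA.eigenvectorUnitary with hW
  have hK : (star (W : Matrix ι ι ℝ) * U * W) ∈ unitaryGroup ι ℝ :=
    mul_mem (mul_mem (Unitary.star_mem W.2) hU) W.2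
  have hspec : A = (W : Matrix ι ι ℝ) * diagonal hA.eigenvalues * star (W : Matrix ι ι ℝ) := by
    simpa [Unitary.conjStarAlgAut_apply, Function.comp_def] using hA.spectral_theorem
  have htr : (U * A).trace
      = (star (W : Matrix ι ι ℝ) * U * W * diagonal hA.eigenvalues).trace := by
    conv_lhs => rw [hspec]
    rw [← Matrix.mul_assoc, trace_mul_comm]
    simp only [Matrix.mul_assoc]
  rw [htr, trace]
  refine Finset.sum_le_sum fun i _ => ?_
  rw [diag_apply, mul_diagonal]
  have h := entry_norm_bound_of_unitary hK i i
  calc _ ≤ |(star (W : Matrix ι ι ℝ) * U * W) i i| * |hA.eigenvalues i| := by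
        rw [← abs_mul]; exact le_abs_self _
    _ ≤ 1 * |hA.eigenvalues i| := by gcongr; exact h
    _ = _ := one_mul _

section Coupling

variable {ι κ η : Type*} [Fintype ι] [DecidableEq ι] [Fintype κ] [DecidableEq κ]
  [Fintype η] {Y : Matrix ι η ℝ} {Z : Matrix κ η ℝ} {P : Matrix η κ ℝ}
  {a : ι → ℝ} {b d : κ → ℝ}

/-- Eigenvectors of `Yᵀ * diagonal a * Y + Zᵀ * diagonal b * Z` for negative eigenvalues
are separated by `Z` when `a` is nonnegative. -/
theorem isUnit_mul_of_negative_eigenvectors (ha : ∀ i, 0 ≤ a i) (hP : Pᵀ * P = 1)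
    (hd : ∀ j, d j < 0)
    (hPe : (Yᵀ * diagonal a * Y + Zᵀ * diagonal b * Z) * P = P * diagonal d) :
    IsUnit (Z * P) := by
  rw [← mulVec_injective_iff_isUnit]
  refine (injective_iff_map_eq_zero (Z * P).mulVecLin).2 fun v hv => ?_
  replace hv : Z *ᵥ (P *ᵥ v) = 0 := by simpa using hv
  have hquad : (P *ᵥ v) ⬝ᵥ ((Yᵀ * diagonal a * Y + Zᵀ * diagonal b * Z) *ᵥ (P *ᵥ v))
      = ∑ j, d j * v j ^ 2 := by
    rw [mulVec_mulVec, hPe, ← vecMul_transpose, ← dotProduct_mulVec, mulVec_mulVec,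
      ← Matrix.mul_assoc, hP, Matrix.one_mul]
    simp only [dotProduct, mulVec_diagonal]
    exact Finset.sum_congr rfl fun j _ => by ring
  have hpos : 0 ≤ ∑ j, d j * v j ^ 2 := by
    rw [← hquad]
    simp only [add_mulVec, ← mulVec_mulVec, hv, mulVec_zero, add_zero]
    rw [dotProduct_mulVec, vecMul_transpose]
    simp only [dotProduct, mulVec_diagonal]
    exact Finset.sum_nonneg fun i _ => by nlinarith [ha i, sq_nonneg ((Y *ᵥ P *ᵥ v) i)]
  have hnonpos : ∀ j ∈ Finset.univ, d j * v j ^ 2 ≤ 0 := fun j _ =>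
    mul_nonpos_of_nonpos_of_nonneg (hd j).le (sq_nonneg _)
  ext j
  have h := (Finset.sum_eq_zero_iff_of_nonpos hnonpos).1
    (le_antisymm (Finset.sum_nonpos hnonpos) hpos) j (Finset.mem_univ j)
  simpa [(hd j).ne] using h

variable {M : Matrix ι κ ℝ}

theorem vecMul_one_eq_neg (hZ : IsUnit (Z * P)) (h0 : a ᵥ* Y + b ᵥ* Z = 0)
    (hM : M * (Z * P) = diagonal a * Y * P) : (1 : ι → ℝ) ᵥ* M = -b := by
  apply vecMul_injective_of_isUnit hZ
  have h : (1 : ι → ℝ) ᵥ* diagonal a = a := by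
    ext i; simp [vecMul_diagonal]
  simp only [vecMul_vecMul, hM]
  rw [← vecMul_vecMul, ← vecMul_vecMul, h, ← vecMul_vecMul, eq_neg_of_add_eq_zero_left h0,
    neg_vecMul, neg_vecMul, neg_vecMul]

theorem transpose_mul_add_mul_one_sub_eq_zero [DecidableEq η] (hZ : IsUnit (Z * P))
    (hP : Pᵀ * P = 1)
    (hPe : (Yᵀ * diagonal a * Y + Zᵀ * diagonal b * Z) * P = P * diagonal d)
    (hM : M * (Z * P) = diagonal a * Y * P) :
    (Mᵀ * Y + diagonal b * Z) * (1 - P * Pᵀ) = 0 := by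
  have hPe' : Pᵀ * (Yᵀ * diagonal a * Y + Zᵀ * diagonal b * Z) = diagonal d * Pᵀ := by
    simpa [Matrix.mul_assoc, transpose_mul] using congrArg transpose hPe
  have hM' : (Z * P)ᵀ * Mᵀ = Pᵀ * Yᵀ * diagonal a := by
    simpa [Matrix.mul_assoc, transpose_mul] using congrArg transpose hM
  have hZ' : IsUnit (Z * P)ᵀ := isUnit_transpose (Z * P) |>.2 hZ
  have : (Z * P)ᵀ * ((Mᵀ * Y + diagonal b * Z) * (1 - P * Pᵀ)) = 0 := by
    calc _ = ((Z * P)ᵀ * Mᵀ * Y + (Z * P)ᵀ * diagonal b * Z) * (1 - P * Pᵀ) := by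
          simp only [Matrix.mul_assoc, Matrix.mul_add, Matrix.add_mul]
      _ = Pᵀ * (Yᵀ * diagonal a * Y + Zᵀ * diagonal b * Z) * (1 - P * Pᵀ) := by
          rw [hM', transpose_mul]
          simp only [Matrix.mul_assoc, Matrix.mul_add, Matrix.add_mul]
      _ = diagonal d * (Pᵀ - Pᵀ * P * Pᵀ) := by
          rw [hPe']
          simp only [Matrix.mul_assoc, Matrix.mul_sub, Matrix.mul_one]
      _ = 0 := by simp [hP]
  obtain ⟨u, hu⟩ := hZ'
  have h := congrArg (fun A => (↑u⁻¹ : Matrix κ κ ℝ) * A) this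
  simpa [← hu, ← Matrix.mul_assoc] using h

end Coupling

theorem Fin.sum_univ_castLE_add {β : Type*} [AddCommMonoid β] {m N : ℕ} (h : m ≤ N)
    (φ : Fin N → β) :
    ∑ i, φ i = ∑ i : Fin m, φ (Fin.castLE h i)
      + ∑ j : Fin (N - m), φ ⟨m + j.1, by have := j.2; omega⟩ := by
  rw [← (finCongr (Nat.add_sub_cancel' h)).sum_comp, Fin.sum_univ_add]
  rfl

/-- If all the parameters `μ_{ij}` (entries of `M = diag(ℓ₊) Y₊ P₋ (Y₋P₋)⁻¹` together with
`μ_{i0} = ℓ_i − Σ_j μ_{ij}`) are nonnegative, then the interpolation error of `f ∈ C¹,¹_ν`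
is bounded by `(ν/2) Σ |λ_i|`, where `λ_i` are the eigenvalues of `G`. -/
theorem stmt_14 (n m : ℕ) (hm1 : 1 ≤ m) (hmn : m ≤ n + 1) (ν : ℝ) (hν : 0 < ν)
    (f : EuclideanSpace ℝ (Fin n) → ℝ)
    (hdiff : Differentiable ℝ f)
    (hlip : ∀ u v, ‖gradient f u - gradient f v‖ ≤ ν * ‖u - v‖)
    (x : Fin (n + 1) → EuclideanSpace ℝ (Fin n)) (hx : AffineIndependent ℝ x)
    (p : EuclideanSpace ℝ (Fin n)) (ℓ : Fin (n + 1) → ℝ)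
    (hsum : ∑ i, ℓ i = 1) (hbary : ∑ i, ℓ i • x i = p)
    (hmono : ∀ i j : Fin (n + 1), i ≤ j → ℓ j ≤ ℓ i)
    (hsign : ∀ i : Fin (n + 1), if (i : ℕ) < m then 0 < ℓ i else ℓ i < 0)
    (fhat : EuclideanSpace ℝ (Fin n) →ᵃ[ℝ] ℝ)
    (hfhat : ∀ i, fhat (x i) = f (x i))
    (G : Matrix (Fin n) (Fin n) ℝ)
    (hG : G = (-1 : ℝ) • vecMulVec p p + ∑ i, ℓ i • vecMulVec (x i) (x i))
    (hGh : G.IsHermitian)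
    (Yplus : Matrix (Fin m) (Fin n) ℝ)
    (hYp : ∀ (i : Fin m) (r : Fin n), Yplus i r = x (Fin.castLE hmn i) r - p r)
    (Yminus : Matrix (Fin (n + 1 - m)) (Fin n) ℝ)
    (hYm : ∀ (j : Fin (n + 1 - m)) (r : Fin n),
      Yminus j r = x ⟨m + j.1, by have := j.2; omega⟩ r - p r)
    (Pminus : Matrix (Fin n) (Fin (n + 1 - m)) ℝ)
    (hPo : Pminusᵀ * Pminus = 1)
    (d : Fin (n + 1 - m) → ℝ) (hd : ∀ j, d j < 0)
    (hPe : G * Pminus = Pminus * Matrix.diagonal d)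
    (M : Matrix (Fin m) (Fin (n + 1 - m)) ℝ)
    (hM : M = Matrix.diagonal (fun i : Fin m => ℓ (Fin.castLE hmn i))
        * Yplus * Pminus * (Yminus * Pminus)⁻¹)
    (μ0 : Fin m → ℝ)
    (hμ0 : ∀ i, μ0 i = ℓ (Fin.castLE hmn i) - ∑ j, M i j)
    (hMpos : ∀ i j, 0 ≤ M i j) (hμ0pos : ∀ i, 0 ≤ μ0 i) :
    |fhat p - f p| ≤ ν / 2 * ∑ i, |hGh.eigenvalues i| := by
  set lp : Fin m → ℝ := fun i => ℓ (Fin.castLE hmn i) with hlp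
  set idx : Fin (n + 1 - m) → Fin (n + 1) :=
    fun j => ⟨m + j.1, by have := j.2; omega⟩ with hidx
  set lm : Fin (n + 1 - m) → ℝ := fun j => ℓ (idx j) with hlm
  have hlp0 : ∀ i, 0 ≤ lp i := fun i => by
    have h := hsign (Fin.castLE hmn i)
    rw [if_pos (by simp)] at h
    exact h.le
  have hbary' : ∀ r, ∑ i, ℓ i * x i r = p r := fun r => by
    simp [← hbary]
  have hGY : Yplusᵀ * diagonal lp * Yplus + Yminusᵀ * diagonal lm * Yminus = G := by
    ext r s
    have h := Fin.sum_univ_castLE_add hmn (fun i => ℓ i * ((x i r - p r) * (x i s - p s)))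
    have h' : ∑ i, ℓ i * ((x i r - p r) * (x i s - p s))
        = ∑ i, ℓ i * (x i r * x i s) - p r * p s := by
      have e : ∀ i, ℓ i * ((x i r - p r) * (x i s - p s)) = ℓ i * (x i r * x i s)
          - (ℓ i * x i r) * p s - (ℓ i * x i s) * p r + ℓ i * (p r * p s) := fun i => by ring
      simp only [e, Finset.sum_add_distrib, Finset.sum_sub_distrib, ← Finset.sum_mul, hbary',
        hsum]
      ring
    have hGrs : G r s = ∑ i, ℓ i * (x i r * x i s) - p r * p s := by
      simp [hG, Matrix.sum_apply, vecMulVec_apply]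
      ring
    rw [hGrs, ← h', h]
    rw [Matrix.add_apply, Matrix.mul_apply, Matrix.mul_apply]
    simp only [mul_diagonal, transpose_apply, hYp, hYm]
    congr 1 <;> exact Finset.sum_congr rfl fun i _ => by ring
  have h0 : lp ᵥ* Yplus + lm ᵥ* Yminus = 0 := by
    ext r
    have h := Fin.sum_univ_castLE_add hmn (fun i => ℓ i * (x i r - p r))
    have h' : ∑ i, ℓ i * (x i r - p r) = 0 := by
      simp [mul_sub, ← Finset.sum_mul, hbary', hsum]
    rw [h'] at h
    simp only [Pi.add_apply, vecMul, dotProduct, hYp, hYm, Pi.zero_apply]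
    exact h.symm
  rw [← hGY] at hPe
  have hZ := isUnit_mul_of_negative_eigenvectors hlp0 hPo hd hPe
  have hM' : M * (Yminus * Pminus) = diagonal lp * Yplus * Pminus := by
    rw [hM, Matrix.mul_assoc _ _ (Yminus * Pminus),
      nonsing_inv_mul _ ((isUnit_iff_isUnit_det _).1 hZ), Matrix.mul_one]
  have hcol : ∀ j, ∑ i, M i j = - lm j := fun j => by
    simpa [vecMul, dotProduct] using congrFun (vecMul_one_eq_neg hZ h0 hM') j
  have hker := transpose_mul_add_mul_one_sub_eq_zero hZ hPo hPe hM'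
  set E := Pminus * Pminusᵀ with hE
  have hEt : Eᵀ = E := by simp [hE, transpose_mul]
  have hEE : E * E = E := by
    rw [hE, Matrix.mul_assoc, ← Matrix.mul_assoc Pminusᵀ, hPo, Matrix.one_mul]
  have hrange : (diagonal lp * Yplus - M * Yminus) * E = 0 := by
    rw [hE, ← Matrix.mul_assoc, Matrix.sub_mul, Matrix.mul_assoc M, hM', sub_self,
      Matrix.zero_mul]
  set Q := toEuclideanLin E with hQ
  have hQs : ∀ u v, ⟪Q u, v⟫_ℝ = ⟪u, Q v⟫_ℝ :=
    isSymmetric_toEuclideanLin_iff.2 (by simpa [IsHermitian] using hEt)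
  have hQi : ∀ u, Q (Q u) = Q u := fun u => by
    simp [hQ, toLpLin_apply, mulVec_mulVec, hEE]
  set a : Fin m → EuclideanSpace ℝ (Fin n) := fun i => x (Fin.castLE hmn i) with ha
  set b : Option (Fin (n + 1 - m)) → EuclideanSpace ℝ (Fin n) :=
    fun j => j.elim p (fun j => x (idx j)) with hb
  set w : Fin m → Option (Fin (n + 1 - m)) → ℝ := fun i j => j.elim (μ0 i) (M.row i) with hw
  have hw0 : ∀ i j, 0 ≤ w i j := fun i j => by
    cases j
    exacts [hμ0pos i, hMpos i _]
  have hrow : ∀ i, ∑ j, w i j = lp i := fun i => by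
    simp [hw, Fintype.sum_option, hμ0, hlp]
  have hplus : ∀ i, ∑ j, w i j • Q (a i - b j) = 0 := fun i => by
    have e : ∑ j, w i j • (a i - b j)
        = WithLp.toLp 2 ((diagonal lp * Yplus - M * Yminus).row i) := by
      ext r
      simp only [row_apply, Matrix.sub_apply, diagonal_mul]
      rw [Matrix.mul_apply]
      simp [hw, ha, hb, Fintype.sum_option, hμ0, hYp, hYm, mul_sub, sub_mul,
        Finset.sum_sub_distrib, Finset.sum_mul, hlp, hidx]
      ring
    simp only [← map_smul, ← map_sum, e]
    simp only [hQ, toLpLin_apply]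
    rw [← hEt, mulVec_transpose]
    have h : (diagonal lp * Yplus - M * Yminus).row i ᵥ* E = 0 := by
      ext s
      exact congrFun (congrFun hrange i) s
    rw [h]
    rfl
  have hsub : ∀ u, u - Q u = toEuclideanLin (1 - E) u := fun u => by
    simp [hQ, map_sub]
  have hEt' : (1 - E)ᵀ = 1 - E := by simp [hEt]
  have hminus : ∀ j, ∑ i, w i j • (a i - b j - Q (a i - b j)) = 0 := fun j => by
    simp only [hsub, ← map_smul, ← map_sum]
    simp only [toLpLin_apply]
    rw [← hEt', mulVec_transpose]
    cases j with
    | some j =>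
      have e : ∑ i, w i (some j) • (a i - b (some j))
          = WithLp.toLp 2 ((Mᵀ * Yplus + diagonal lm * Yminus).row j) := by
        ext r
        simp only [row_apply, Matrix.add_apply, diagonal_mul]
        rw [Matrix.mul_apply]
        simp [hw, ha, hb, hYp, hYm, mul_sub, Finset.sum_sub_distrib,
          ← Finset.sum_mul, hcol, hidx]
      have h : (Mᵀ * Yplus + diagonal lm * Yminus).row j ᵥ* (1 - E) = 0 := by
        ext s
        exact congrFun (congrFun hker j) s
      rw [e, h]
      rfl
    | none =>
      have e : (∑ i, w i none • (a i - b none)).ofLp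
          = - ((1 : Fin (n + 1 - m) → ℝ) ᵥ* (Mᵀ * Yplus + diagonal lm * Yminus)) := by
        have h1 : (1 : Fin (n + 1 - m) → ℝ) ᵥ* diagonal lm = lm := by
          ext; simp [vecMul_diagonal]
        rw [vecMul_add, ← vecMul_vecMul, ← vecMul_vecMul, h1, eq_neg_of_add_eq_zero_right h0,
          ← sub_eq_add_neg, ← sub_vecMul, ← neg_vecMul, neg_sub]
        ext r
        simp [hw, ha, hb, vecMul, dotProduct, hμ0, hYp, hlp]
      rw [e, neg_vecMul, vecMul_vecMul, hker]
      simp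
  have hmarg : ∀ φ : EuclideanSpace ℝ (Fin n) → ℝ,
      ∑ i, ∑ j, w i j * (φ (a i) - φ (b j)) = ∑ i, ℓ i * φ (x i) - φ p := fun φ => by
    have hcol0 : ∑ i, w i none = 1 := by
      have h := Fin.sum_univ_castLE_add hmn ℓ
      have hcomm : ∑ i, ∑ j, M i j = - ∑ j, lm j := by
        refine Finset.sum_comm.trans ?_
        simp [hcol]
      simp only [hw, Option.elim_none, hμ0, Finset.sum_sub_distrib, hcomm]
      rw [hsum] at h
      linarith
    simp only [mul_sub, Finset.sum_sub_distrib, ← Finset.sum_mul, hrow]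
    rw [Finset.sum_comm]
    simp only [← Finset.sum_mul, Fintype.sum_option, hcol0]
    rw [Fin.sum_univ_castLE_add hmn (fun i => ℓ i * φ (x i))]
    simp [hw, hb, hcol]
    ring
  have hU : (1 - (2 : ℝ) • E) ∈ unitaryGroup (Fin n) ℝ := by
    rw [mem_unitaryGroup_iff, star_eq_conjTranspose, conjTranspose_eq_transpose_of_trivial]
    simp only [transpose_sub, transpose_one, transpose_smul, hEt, Matrix.sub_mul, Matrix.mul_sub,
      Matrix.one_mul, Matrix.mul_one, Matrix.smul_mul, Matrix.mul_smul, hEE]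
    module
  have hform : ∀ u : EuclideanSpace ℝ (Fin n), ⟪u - (2 : ℝ) • Q u, u⟫_ℝ
      = ((1 - (2 : ℝ) • E) * vecMulVec u u).trace := fun u => by
    rw [mul_vecMulVec, trace_vecMulVec, dotProduct_comm]
    simp [hQ, EuclideanSpace.inner_eq_star_dotProduct, sub_mulVec, smul_mulVec]
  have hquad : ∑ i, ∑ j, w i j *
      (⟪a i - (2 : ℝ) • Q (a i), a i⟫_ℝ - ⟪b j - (2 : ℝ) • Q (b j), b j⟫_ℝ)
        ≤ ∑ i, |hGh.eigenvalues i| := by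
    rw [hmarg (fun u => ⟪u - (2 : ℝ) • Q u, u⟫_ℝ)]
    refine le_trans (le_of_eq ?_) (hGh.trace_unitary_mul_le hU)
    simp only [hform]
    rw [hG, Matrix.mul_add, Matrix.mul_sum, trace_add, trace_sum]
    simp only [Matrix.mul_smul, trace_smul, smul_eq_mul]
    ring
  have hbound : ∀ (F : EuclideanSpace ℝ (Fin n) → ℝ)
      (g : EuclideanSpace ℝ (Fin n) → EuclideanSpace ℝ (Fin n)),
      (∀ u v, |F u - F v - ⟪g v, u - v⟫_ℝ| ≤ ν / 2 * ‖u - v‖ ^ 2) →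
        ∑ i, ℓ i * F (x i) - F p ≤ ν / 2 * ∑ i, |hGh.eigenvalues i| := fun F g hF => by
    rw [← hmarg F]
    exact (sum_mul_sub_le_of_projection hF Q hQs hQi a b w hw0 hplus hminus).trans
      (mul_le_mul_of_nonneg_left hquad (by positivity))
  have hfp : fhat p = ∑ i, ℓ i * f (x i) := by
    have hdec : ∀ v, fhat v = fhat.linear v + fhat 0 := congrFun fhat.decomp
    calc fhat p = ∑ i, ℓ i * fhat.linear (x i) + (∑ i, ℓ i) * fhat 0 := by
          rw [hdec p, ← hbary, hsum]
          simp
      _ = ∑ i, ℓ i * f (x i) := by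
          simp only [← hfhat, hdec (x _), mul_add, Finset.sum_add_distrib, Finset.sum_mul]
  have htaylor := sub_sub_inner_gradient_le hdiff hlip
  have hupper := hbound f (gradient f) htaylor
  have hlower := hbound (fun u => - f u) (fun u => - gradient f u) fun u v => by
    rw [← abs_neg, inner_neg_left]
    convert htaylor u v using 2
    ring
  simp only [mul_neg, Finset.sum_neg_distrib] at hlower
  rw [hfp, abs_le]
  constructor <;> linarith
end

section
/- Let a₁ ≤ a₂ ≤ … ≤ a_{n+1} be real numbers with n ≥ 1, let μ = (1/(n+1)) Σ_{i=1}^{n+1} a_i be their mean and σ² = (1/(n+1)) Σ_{i=1}^{n+1} (a_i − μ)² their variance (σ ≥ 0). Then a_{n+1} ≥ μ + σ/√n. -/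
/-- For sorted reals `a₁ ≤ … ≤ a_{n+1}` with mean `μ` and standard deviation `σ`,
the largest one satisfies `a_{n+1} ≥ μ + σ/√n`. -/
theorem stmt_16 (n : ℕ) (hn : 1 ≤ n) (a : Fin (n + 1) → ℝ) (hmono : Monotone a) :
    (∑ i, a i) / (n + 1)
        + Real.sqrt ((∑ i, (a i - (∑ j, a j) / (n + 1)) ^ 2) / (n + 1)) / Real.sqrt n
      ≤ a (Fin.last n) := by
  have hn0 : (0 : ℝ) < n := by exact_mod_cast hn
  have hn1 : (0 : ℝ) < n + 1 := by positivity
  set m := (∑ j, a j) / ((n : ℝ) + 1) with hm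
  have hsum : ∑ j, a j = (n + 1) * m := by rw [hm]; field_simp
  set M := a (Fin.last n) - m with hM
  have hd : ∀ i ∈ Finset.univ, 0 ≤ a (Fin.last n) - a i := fun i _ =>
    sub_nonneg.2 (hmono (Fin.le_last i))
  have hdsum : ∑ i, (a (Fin.last n) - a i) = (n + 1) * M := by
    rw [Finset.sum_sub_distrib, hsum]
    simp [hM]
    ring
  have hM0 : 0 ≤ M := by
    have h := Finset.sum_nonneg hd
    rw [hdsum] at h
    exact nonneg_of_mul_nonneg_right h hn1
  have hsq : ∑ i, (a (Fin.last n) - a i) ^ 2 ≤ ((n + 1) * M) ^ 2 := by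
    calc ∑ i, (a (Fin.last n) - a i) ^ 2
        ≤ ∑ i, (a (Fin.last n) - a i) * ((n + 1) * M) := by
          refine Finset.sum_le_sum fun i hi => ?_
          rw [sq, ← hdsum]
          exact mul_le_mul_of_nonneg_left (Finset.single_le_sum hd hi) (hd i hi)
      _ = ((n + 1) * M) ^ 2 := by rw [← Finset.sum_mul, hdsum, sq]
  have hvar : ∑ i, (a i - m) ^ 2 = ∑ i, (a (Fin.last n) - a i) ^ 2 - (n + 1) * M ^ 2 := by
    have h : ∀ i, (a i - m) ^ 2
        = (a (Fin.last n) - a i) ^ 2 - 2 * M * (a (Fin.last n) - a i) + M ^ 2 := fun i => by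
      rw [hM]; ring
    simp only [h, Finset.sum_add_distrib, Finset.sum_sub_distrib, ← Finset.mul_sum]
    rw [← Finset.sum_sub_distrib, hdsum]
    simp
    ring
  have key : Real.sqrt ((∑ i, (a i - m) ^ 2) / (n + 1)) ≤ M * Real.sqrt n := by
    refine Real.sqrt_le_iff.2 ⟨by positivity, ?_⟩
    rw [mul_pow, Real.sq_sqrt hn0.le, div_le_iff₀ hn1, hvar]
    linarith
  have := (div_le_iff₀ (Real.sqrt_pos.2 hn0)).2 key
  linarith
end

section
/- Assume f ∈ C¹,¹_ν(ℝ²). Let f̂ be the affine function interpolating f on an affinely independent set Θ = {x₁, x₂, x₃} ⊂ ℝ² with (x₂ − x₁)·(x₃ − x₁) < 0, and let x ∈ ℝ² have barycentric coordinates ℓ₁, ℓ₂, ℓ₃ with respect to Θ satisfying ℓ₂ > 0, ℓ₃ < 0, and ℓ₁(x₂ − x₁)·(x₃ − x₁) − ℓ₃(x₂ − x₃)·(x₁ − x₃) < 0. Set x₀ = x, ℓ₀ = −1, G = Σ_{i=0}^{3} ℓ_i x_i x_iᵀ, and H* = P diag(ν, −ν) P⁻¹ where P ∈ ℝ^{2×2}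 has columns x₂ − x and x₁ − x₃ (P is invertible under the assumptions). Then |f̂(x) − f(x)| ≤ (1/2) Tr(G H*). -/
open Matrix
open scoped InnerProductSpace

/-- First-order Taylor estimate for a function with `ν`-Lipschitz gradient. -/
theorem abs_sub_sub_inner_gradient_le {E : Type*} [NormedAddCommGroup E] [InnerProductSpace ℝ E]
    [CompleteSpace E] {ν : ℝ} {f : E → ℝ} (hdiff : Differentiable ℝ f)
    (hlip : ∀ u v, ‖gradient f u - gradient f v‖ ≤ ν * ‖u - v‖) (z d : E) :
    |f (z + d) - f z - ⟪gradient f z, d⟫_ℝ| ≤ ν / 2 * ‖d‖ ^ 2 := by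
  have hline (t : ℝ) : HasDerivAt (fun s : ℝ => z + s • d) d t := by
    simpa using ((hasDerivAt_id t).smul_const d).const_add z
  have hg (t : ℝ) : HasDerivAt (fun s : ℝ => f (z + s • d) - f z - s * ⟪gradient f z, d⟫_ℝ)
      (⟪gradient f (z + t • d) - gradient f z, d⟫_ℝ) t := by
    have h1 := (hdiff (z + t • d)).hasGradientAt.hasFDerivAt.comp_hasDerivAt t (hline t)
    have h2 := (h1.sub_const (f z)).sub ((hasDerivAt_id t).mul_const ⟪gradient f z, d⟫_ℝ)
    rw [one_mul] at h2
    rw [inner_sub_left]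
    exact h2
  have hB (t : ℝ) : HasDerivAt (fun s : ℝ => ν / 2 * ‖d‖ ^ 2 * s ^ 2) (ν * ‖d‖ ^ 2 * t) t := by
    refine ((hasDerivAt_pow 2 t).const_mul (ν / 2 * ‖d‖ ^ 2)).congr_deriv ?_
    push_cast
    ring
  have key := image_norm_le_of_norm_deriv_right_le_deriv_boundary (a := 0) (b := 1)
    (fun t _ => (hg t).continuousAt.continuousWithinAt)
    (fun t _ => (hg t).hasDerivWithinAt) (by simp) hB
    (fun t ht => by
      have h1 := norm_inner_le_norm (𝕜 := ℝ) (gradient f (z + t • d) - gradient f z) d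
      have h2 := hlip (z + t • d) z
      rw [add_sub_cancel_left, norm_smul, Real.norm_of_nonneg ht.1] at h2
      nlinarith [norm_nonneg d])
    (Set.right_mem_Icc.2 zero_le_one)
  simpa using key

/-- Error of linear interpolation on a segment for a function with `ν`-Lipschitz gradient. -/
theorem abs_segment_interpolation_sub_le {E : Type*} [NormedAddCommGroup E]
    [InnerProductSpace ℝ E] [CompleteSpace E] {ν : ℝ} {f : E → ℝ} (hdiff : Differentiable ℝ f)
    (hlip : ∀ u v, ‖gradient f u - gradient f v‖ ≤ ν * ‖u - v‖) (a b : E) {t : ℝ}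
    (h0 : 0 ≤ t) (h1 : t ≤ 1) :
    |t * f a + (1 - t) * f b - f (t • a + (1 - t) • b)|
      ≤ ν / 2 * (t * (1 - t) * ‖a - b‖ ^ 2) := by
  set z := t • a + (1 - t) • b with hz
  have ha := abs_sub_sub_inner_gradient_le hdiff hlip z ((1 - t) • (a - b))
  have hb := abs_sub_sub_inner_gradient_le hdiff hlip z (-t • (a - b))
  rw [show z + (1 - t) • (a - b) = a by rw [hz]; module, norm_smul, inner_smul_right,
    mul_pow, Real.norm_eq_abs, sq_abs, abs_le] at ha
  rw [show z + -t • (a - b) = b by rw [hz]; module, norm_smul, inner_smul_right,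
    mul_pow, Real.norm_eq_abs, sq_abs, abs_le] at hb
  have h1' : 0 ≤ 1 - t := by linarith
  rw [abs_le]
  constructor
  · linear_combination t * ha.1 + (1 - t) * hb.1
  · linear_combination t * ha.2 + (1 - t) * hb.2

/-- The trace of `P C Pᵀ` against `P D P⁻¹`, for diagonal `C` and `D`. -/
theorem trace_mul_diagonal_mul_transpose_mul_conj {n : Type*} [Fintype n] [DecidableEq n]
    (P : Matrix n n ℝ) (hP : P.det ≠ 0) (c d : n → ℝ) :
    (P * diagonal c * Pᵀ * (P * diagonal d * P⁻¹)).trace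
      = ∑ i, c i * d i * ∑ r, P r i ^ 2 := by
  rw [← Matrix.mul_assoc, Matrix.trace_mul_comm, Matrix.mul_assoc P, Matrix.mul_assoc P,
    ← Matrix.mul_assoc, Matrix.nonsing_inv_mul _ hP.isUnit, Matrix.one_mul]
  simp only [Matrix.trace, Matrix.diag_apply, Matrix.mul_assoc, Matrix.diagonal_mul]
  refine Finset.sum_congr rfl fun i _ => ?_
  rw [← Matrix.mul_assoc, Matrix.mul_diagonal, Matrix.mul_apply, mul_assoc, mul_comm (d i)]
  simp only [Matrix.transpose_apply, sq]

/-- Sharp bound for bivariate extrapolation in the obtuse-triangle configuration: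
`|f̂(x) − f(x)| ≤ (1/2) Tr(G H*)` with `H* = P diag(ν, −ν) P⁻¹`, where the columns of `P`
are `x₂ − x` and `x₁ − x₃`, and `G = Σ_{i=0}^{3} ℓᵢ xᵢ xᵢᵀ` (`x₀ = x`, `ℓ₀ = −1`). -/
theorem stmt_17 (ν : ℝ) (hν : 0 < ν)
    (f : EuclideanSpace ℝ (Fin 2) → ℝ)
    (hdiff : Differentiable ℝ f)
    (hlip : ∀ u v, ‖gradient f u - gradient f v‖ ≤ ν * ‖u - v‖)
    (x1 x2 x3 p : EuclideanSpace ℝ (Fin 2))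
    (hx : AffineIndependent ℝ ![x1, x2, x3])
    (hobt : ⟪x2 - x1, x3 - x1⟫_ℝ < 0)
    (l1 l2 l3 : ℝ) (hsum : l1 + l2 + l3 = 1)
    (hbary : l1 • x1 + l2 • x2 + l3 • x3 = p)
    (hl2 : 0 < l2) (hl3 : l3 < 0)
    (hkey : l1 * ⟪x2 - x1, x3 - x1⟫_ℝ - l3 * ⟪x2 - x3, x1 - x3⟫_ℝ < 0)
    (fhat : EuclideanSpace ℝ (Fin 2) →ᵃ[ℝ] ℝ)
    (hfhat1 : fhat x1 = f x1) (hfhat2 : fhat x2 = f x2) (hfhat3 : fhat x3 = f x3)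
    (G : Matrix (Fin 2) (Fin 2) ℝ)
    (hG : G = (-1 : ℝ) • vecMulVec p p + l1 • vecMulVec x1 x1
        + l2 • vecMulVec x2 x2 + l3 • vecMulVec x3 x3)
    (P : Matrix (Fin 2) (Fin 2) ℝ)
    (hP : ∀ r : Fin 2, P r 0 = (x2 - p) r ∧ P r 1 = (x1 - x3) r)
    (Hstar : Matrix (Fin 2) (Fin 2) ℝ)
    (hHstar : Hstar = P * Matrix.diagonal ![ν, -ν] * P⁻¹) :
    |fhat p - f p| ≤ 1 / 2 * (G * Hstar).trace := by
  have hb3 : ⟪x2 - x3, x1 - x3⟫_ℝ = ‖x1 - x3‖ ^ 2 - ⟪x2 - x1, x3 - x1⟫_ℝ := by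
    rw [← real_inner_self_eq_norm_sq]
    simp only [inner_sub_left, inner_sub_right]
    ring
  have hl1 : 0 < l1 := by
    by_contra! h
    nlinarith [sq_nonneg ‖x1 - x3‖, mul_nonneg_of_nonpos_of_nonpos h hobt.le,
      mul_pos_of_neg_of_neg hl3 hobt, mul_nonneg (neg_nonneg.2 hl3.le) (sq_nonneg ‖x1 - x3‖)]
  have hl13 : 0 < l1 + l3 := by
    by_contra! h
    nlinarith [mul_nonneg_of_nonpos_of_nonpos h hobt.le,
      mul_nonneg (neg_nonneg.2 hl3.le) (sq_nonneg ‖x1 - x3‖)]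
  obtain rfl : l2 = 1 - (l1 + l3) := by linarith
  have hne := hl13.ne'
  have hdet : P.det ≠ 0 := by
    intro h
    rw [Matrix.det_fin_two, (hP 0).1, (hP 1).1, (hP 0).2, (hP 1).2, ← hbary] at h
    have h' : (x2 - x1) 0 * (x3 - x1) 1 - (x2 - x1) 1 * (x3 - x1) 0 = 0 := by
      apply mul_left_cancel₀ hne
      rw [mul_zero]
      simp only [PiLp.sub_apply, PiLp.add_apply, PiLp.smul_apply, smul_eq_mul] at h ⊢
      linear_combination -h
    have hli : LinearIndependent ℝ ![x2 - x1, x3 - x1] := by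
      rw [affineIndependent_iff_linearIndependent_vsub ℝ _ (0 : Fin 3),
        ← linearIndependent_equiv (finSuccAboveEquiv (0 : Fin 3))] at hx
      convert! hx using 1
      ext i : 1
      fin_cases i <;> rfl
    rw [LinearIndependent.pair_iff] at hli
    have h0 := (hli ((x3 - x1) 0) (-(x2 - x1) 0) (by
      ext i
      fin_cases i <;> simp at h' ⊢
      · ring
      · linear_combination -h')).1
    have h1 := (hli ((x3 - x1) 1) (-(x2 - x1) 1) (by
      ext i
      fin_cases i <;> simp at h' ⊢
      · linear_combination h'
      · ring)).1
    have : x3 - x1 = 0 := by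
      ext i
      fin_cases i
      exacts [h0, h1]
    simp [this] at hobt
  have hGP : G = P * diagonal ![(1 - (l1 + l3)) / (l1 + l3), l1 * l3 / (l1 + l3)] * Pᵀ := by
    subst hG hbary
    ext i j
    simp [Matrix.mul_apply, Fin.sum_univ_two, diagonal, vecMulVec_apply, (hP _).1, (hP _).2]
    field_simp
    ring
  have htr : (G * Hstar).trace = ν * ((1 - (l1 + l3)) / (l1 + l3) * ‖x2 - p‖ ^ 2
      - l1 * l3 / (l1 + l3) * ‖x1 - x3‖ ^ 2) := by
    rw [hGP, hHstar, trace_mul_diagonal_mul_transpose_mul_conj P hdet]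
    simp only [EuclideanSpace.norm_sq_eq, Fin.sum_univ_two, (hP _).1, (hP _).2,
      Real.norm_eq_abs, sq_abs, Matrix.cons_val_zero, Matrix.cons_val_one]
    ring
  set w := (l1 + l3)⁻¹ • (l1 • x1 + l3 • x3) with hw
  have hfp : fhat p = l1 * f x1 + (1 - (l1 + l3)) * f x2 + l3 * f x3 := by
    rw [← hfhat1, ← hfhat2, ← hfhat3, ← hbary, AffineMap.decomp fhat]
    simp only [Pi.add_apply, map_add, map_smul, smul_eq_mul]
    ring
  have hpw : (1 - (l1 + l3)) • x2 + (1 - (1 - (l1 + l3))) • w = p := by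
    rw [← hbary, hw, sub_sub_cancel, smul_inv_smul₀ hne]
    module
  have hx1w : (-l3 / l1) • x3 + (1 - -l3 / l1) • w = x1 := by
    rw [hw]
    match_scalars <;> field_simp <;> ring
  have hx2w : x2 - w = (l1 + l3)⁻¹ • (x2 - p) := by
    rw [← hbary, hw]
    match_scalars <;> field_simp
    ring
  have hx3w : x3 - w = (-l1 / (l1 + l3)) • (x1 - x3) := by
    rw [hw]
    match_scalars <;> field_simp
    ring
  have e1 := abs_segment_interpolation_sub_le hdiff hlip x2 w hl2.le (by linarith)
  have e2 := abs_segment_interpolation_sub_le hdiff hlip x3 w (t := -l3 / l1)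
    (div_nonneg (by linarith) hl1.le) ((div_le_one hl1).2 (by linarith))
  rw [hpw, hx2w, norm_smul, mul_pow, Real.norm_eq_abs, sq_abs] at e1
  rw [hx1w, hx3w, norm_smul, mul_pow, Real.norm_eq_abs, sq_abs] at e2
  have hsplit : fhat p - f p
      = ((1 - (l1 + l3)) * f x2 + (1 - (1 - (l1 + l3))) * f w - f p)
        - l1 * (-l3 / l1 * f x3 + (1 - -l3 / l1) * f w - f x1) := by
    rw [hfp]
    field_simp
    ring
  have e2' := mul_le_mul_of_nonneg_left e2 hl1.le
  rw [← abs_of_pos hl1, ← abs_mul, abs_of_pos hl1] at e2'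
  rw [hsplit, htr]
  refine (abs_sub _ _).trans ((add_le_add e1 e2').trans_eq ?_)
  field_simp
  ring
end

section
/- Let Θ = {x₁, x₂, x₃} ⊂ ℝ² be affinely independent with (x₂ − x₁)·(x₃ − x₁) < 0, and let x ∈ ℝ² have barycentric coordinates ℓ₁, ℓ₂, ℓ₃ with respect to Θ satisfying ℓ₂ > 0, ℓ₃ < 0, and ℓ₁(x₂ − x₁)·(x₃ − x₁) − ℓ₃(x₂ − x₃)·(x₁ − x₃) < 0. Set x₀ = x, ℓ₀ = −1, G = Σ_{i=0}^{3} ℓ_i x_i x_iᵀ, H* = P diag(ν, −ν) P⁻¹ with P = [x₂ − x, x₁ − x₃], and w = (−ℓ₀x + ℓ₁x₁ − ℓ₂x₂ + ℓ₃x₃)/(−ℓ₀ + ℓ₁ − ℓ₂ + ℓ₃). Define f: ℝ² → ℝ by f(u) = (ν/2)‖u − w‖² − ν[(x₁ − x₃)·(u − w)]²/‖x₁ − x₃‖² if (u − w)·(x₁ − x₃) ≤ 0, and f(u) = (ν/2)‖u − w‖² if (u − w)·(x₁ − x₃) ≥ 0. Then f ∈ C¹,¹_ν(ℝ²), and its affine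 interpolant f̂ on Θ satisfies f̂(x) − f(x) = (1/2) Tr(G H*). -/
open Matrix
open scoped InnerProductSpace

/-- The square of the negative part is differentiable. -/
theorem hasDerivAt_min_zero_sq (t : ℝ) :
    HasDerivAt (fun s : ℝ => min 0 s ^ 2) (2 * min 0 t) t := by
  have hO : (fun s : ℝ => min 0 s ^ 2 - min 0 t ^ 2 - 2 * min 0 t * (s - t))
      =O[nhds t] fun s => ‖s - t‖ ^ 2 := by
    refine Asymptotics.IsBigO.of_bound 1 (Filter.Eventually.of_forall fun s => ?_)
    rw [Real.norm_eq_abs, Real.norm_eq_abs, Real.norm_eq_abs, sq_abs, one_mul,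
      abs_of_nonneg (sq_nonneg (s - t)), abs_le]
    rcases le_total 0 s with hs | hs <;> rcases le_total 0 t with ht | ht <;>
      simp only [min_eq_left, min_eq_right, hs, ht] <;> constructor <;> nlinarith
  have h0 := (hO.hasFDerivAt one_lt_two).hasDerivAt
  have h1 : HasDerivAt (fun s : ℝ => min 0 t ^ 2 + 2 * min 0 t * (s - t)) (2 * min 0 t) t := by
    simpa using (((hasDerivAt_id t).sub_const t).const_mul (2 * min 0 t)).const_add (min 0 t ^ 2)
  refine ((h0.add h1).congr_of_eventuallyEq (Filter.Eventually.of_forall fun s => ?_)).congr_deriv ?_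
  · simp only [Pi.add_apply]
    ring
  · simp

section InnerProductSpace

variable {V : Type*} [NormedAddCommGroup V] [InnerProductSpace ℝ V]

/-- The gradient of a squared distance minus a squared negative part of a linear functional. -/
theorem hasGradientAt_sq_norm_sub_min_sq [CompleteSpace V] (ν c : ℝ) (e w u : V) :
    HasGradientAt (fun u => ν / 2 * ‖u - w‖ ^ 2 - c * min 0 ⟪e, u - w⟫_ℝ ^ 2)
      (ν • (u - w) - (2 * c * min 0 ⟪e, u - w⟫_ℝ) • e) u := by
  have h1 : HasFDerivAt (fun u : V => u - w) (ContinuousLinearMap.id ℝ V) u :=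
    (hasFDerivAt_id u).sub_const w
  have h2 : HasFDerivAt (fun u : V => ⟪e, u - w⟫_ℝ) (innerSL ℝ e) u :=
    (innerSL ℝ e).hasFDerivAt.comp u h1
  have h3 := (hasDerivAt_min_zero_sq ⟪e, u - w⟫_ℝ).comp_hasFDerivAt u h2
  rw [hasGradientAt_iff_hasFDerivAt]
  refine ((h1.norm_sq.const_mul (ν / 2)).sub (h3.const_mul c)).congr_fderiv ?_
  ext z
  simp
  ring

/-- The gradient in `hasGradientAt_sq_norm_sub_min_sq` is `ν`-Lipschitz for `c = ν / ‖e‖ ^ 2`. -/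
theorem norm_smul_sub_smul_min_sub_le {ν : ℝ} (hν : 0 ≤ ν) {e : V} (he : e ≠ 0) (w u v : V) :
    ‖(ν • (u - w) - (2 * (ν / ‖e‖ ^ 2) * min 0 ⟪e, u - w⟫_ℝ) • e)
      - (ν • (v - w) - (2 * (ν / ‖e‖ ^ 2) * min 0 ⟪e, v - w⟫_ℝ) • e)‖ ≤ ν * ‖u - v‖ := by
  have hE : 0 < ‖e‖ ^ 2 := by positivity
  obtain ⟨m, hm⟩ : ∃ m, m = min 0 ⟪e, u - w⟫_ℝ - min 0 ⟪e, v - w⟫_ℝ := ⟨_, rfl⟩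
  have hmc : m ^ 2 ≤ m * ⟪e, u - v⟫_ℝ := by
    have : ⟪e, u - v⟫_ℝ = ⟪e, u - w⟫_ℝ - ⟪e, v - w⟫_ℝ := by
      rw [← inner_sub_right]; congr 1; abel
    rw [this, hm]
    rcases le_total 0 ⟪e, u - w⟫_ℝ with hs | hs <;> rcases le_total 0 ⟪e, v - w⟫_ℝ with ht | ht <;>
      simp only [min_eq_left, min_eq_right, hs, ht] <;> nlinarith
  have heq : (ν • (u - w) - (2 * (ν / ‖e‖ ^ 2) * min 0 ⟪e, u - w⟫_ℝ) • e)
      - (ν • (v - w) - (2 * (ν / ‖e‖ ^ 2) * min 0 ⟪e, v - w⟫_ℝ) • e)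
      = ν • ((u - v) - (2 * m / ‖e‖ ^ 2) • e) := by
    rw [hm]; module
  rw [heq, norm_smul, Real.norm_of_nonneg hν]
  refine mul_le_mul_of_nonneg_left ?_ hν
  refine (sq_le_sq₀ (norm_nonneg _) (norm_nonneg _)).1 ?_
  rw [norm_sub_sq_real, norm_smul, mul_pow, Real.norm_eq_abs, sq_abs, inner_smul_right,
    real_inner_comm]
  have : -(2 * (2 * m / ‖e‖ ^ 2 * ⟪e, u - v⟫_ℝ)) + (2 * m / ‖e‖ ^ 2) ^ 2 * ‖e‖ ^ 2
      = 4 / ‖e‖ ^ 2 * (m ^ 2 - m * ⟪e, u - v⟫_ℝ) := by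
    field_simp
    ring
  have : 4 / ‖e‖ ^ 2 * (m ^ 2 - m * ⟪e, u - v⟫_ℝ) ≤ 0 :=
    mul_nonpos_of_nonneg_of_nonpos (by positivity) (by linarith)
  linarith

end InnerProductSpace

/-- The vectors `x₂ - p` and `x₁ - x₃` are linearly independent when `p` is off the line through
`x₂` parallel to the side `x₁ x₃`. -/
theorem eq_zero_of_smul_sub_add_smul_sub_eq_zero {V : Type*} [AddCommGroup V] [Module ℝ V]
    {x1 x2 x3 p : V} (hx : AffineIndependent ℝ ![x1, x2, x3]) {l1 l2 l3 : ℝ}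
    (hsum : l1 + l2 + l3 = 1) (hbary : l1 • x1 + l2 • x2 + l3 • x3 = p)
    (hD : l1 + l3 ≠ 0) {a b : ℝ} (hab : a • (x2 - p) + b • (x1 - x3) = 0) : a = 0 ∧ b = 0 := by
  rw [affineIndependent_iff] at hx
  have h := hx Finset.univ ![b - a * l1, a * (l1 + l3), -(a * l3) - b]
    (by simp [Fin.sum_univ_three]; ring)
    (by
      rw [← hab, ← hbary]
      obtain rfl : l2 = 1 - l1 - l3 := by linarith
      simp only [Fin.sum_univ_three, cons_val_zero, cons_val_one, cons_val]
      module)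
  have h1 := h 1 (Finset.mem_univ _)
  have h0 := h 0 (Finset.mem_univ _)
  simp only [cons_val_zero, cons_val_one] at h0 h1
  obtain rfl : a = 0 := (mul_eq_zero.1 h1).resolve_right hD
  exact ⟨rfl, by simpa using h0⟩

/-- `Tr (v vᵀ H) = c ‖v‖²` for an eigenvector `v` of `H` with eigenvalue `c`. -/
theorem trace_vecMulVec_self_mul_of_mulVec_eq {n : Type*} [Fintype n]
    (H : Matrix n n ℝ) (v : EuclideanSpace ℝ n) {c : ℝ} (h : H *ᵥ v.ofLp = c • v.ofLp) :
    (vecMulVec v v * H).trace = c * ‖v‖ ^ 2 := by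
  rw [vecMulVec_mul, trace_vecMulVec, dotProduct_comm, ← dotProduct_mulVec, h, dotProduct_smul,
    smul_eq_mul, EuclideanSpace.real_norm_sq_eq]
  simp [dotProduct, sq]

/-- The bound `(1/2) Tr(G H*)` for the bivariate obtuse configuration is attained by an
explicit piecewise quadratic function, which belongs to `C¹,¹_ν(ℝ²)`. -/
theorem stmt_18 (ν : ℝ) (hν : 0 < ν)
    (x1 x2 x3 p : EuclideanSpace ℝ (Fin 2))
    (hx : AffineIndependent ℝ ![x1, x2, x3])
    (hobt : ⟪x2 - x1, x3 - x1⟫_ℝ < 0)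
    (l1 l2 l3 : ℝ) (hsum : l1 + l2 + l3 = 1)
    (hbary : l1 • x1 + l2 • x2 + l3 • x3 = p)
    (hl2 : 0 < l2) (hl3 : l3 < 0)
    (hkey : l1 * ⟪x2 - x1, x3 - x1⟫_ℝ - l3 * ⟪x2 - x3, x1 - x3⟫_ℝ < 0)
    (G : Matrix (Fin 2) (Fin 2) ℝ)
    (hG : G = (-1 : ℝ) • vecMulVec p p + l1 • vecMulVec x1 x1
        + l2 • vecMulVec x2 x2 + l3 • vecMulVec x3 x3)
    (P : Matrix (Fin 2) (Fin 2) ℝ)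
    (hP : ∀ r : Fin 2, P r 0 = (x2 - p) r ∧ P r 1 = (x1 - x3) r)
    (Hstar : Matrix (Fin 2) (Fin 2) ℝ)
    (hHstar : Hstar = P * Matrix.diagonal ![ν, -ν] * P⁻¹)
    (w : EuclideanSpace ℝ (Fin 2))
    (hw : w = (1 + l1 - l2 + l3)⁻¹ • ((1 : ℝ) • p + l1 • x1 - l2 • x2 + l3 • x3))
    (f : EuclideanSpace ℝ (Fin 2) → ℝ)
    (hf : ∀ u, f u =
      if ⟪u - w, x1 - x3⟫_ℝ ≤ 0 then
        ν / 2 * ‖u - w‖ ^ 2 - ν * ⟪x1 - x3, u - w⟫_ℝ ^ 2 / ‖x1 - x3‖ ^ 2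
      else ν / 2 * ‖u - w‖ ^ 2)
    (fhat : EuclideanSpace ℝ (Fin 2) →ᵃ[ℝ] ℝ)
    (hfhat1 : fhat x1 = f x1) (hfhat2 : fhat x2 = f x2) (hfhat3 : fhat x3 = f x3) :
    Differentiable ℝ f ∧
    (∀ u v, ‖gradient f u - gradient f v‖ ≤ ν * ‖u - v‖) ∧
    fhat p - f p = 1 / 2 * (G * Hstar).trace := by
  obtain ⟨e, he⟩ : ∃ e, e = x1 - x3 := ⟨_, rfl⟩
  have he0 : e ≠ 0 := by
    rintro rfl
    rw [← neg_sub x1 x3, ← he] at hobt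
    simp at hobt
  have hE : 0 < ‖e‖ ^ 2 := by positivity
  obtain ⟨A, hA⟩ : ∃ A, A = ⟪x2 - x1, x3 - x1⟫_ℝ := ⟨_, rfl⟩
  have hA' : ⟪x2 - x3, x1 - x3⟫_ℝ = ‖e‖ ^ 2 - A := by
    rw [hA, ← real_inner_self_eq_norm_sq, he, ← neg_sub x1 x3, inner_neg_right, sub_neg_eq_add,
      ← inner_add_left]
    congr 1
    abel
  rw [← hA] at hobt
  rw [hA', ← hA] at hkey
  have hkey' : (l1 + l3) * A < l3 * ‖e‖ ^ 2 := by linarith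
  have hl3E : l3 * ‖e‖ ^ 2 < 0 := mul_neg_of_neg_of_pos hl3 hE
  have hD : 0 < l1 + l3 := by nlinarith
  have hl1 : 0 < l1 := by linarith
  obtain ⟨D, hDdef⟩ : ∃ D, D = l1 + l3 := ⟨_, rfl⟩
  rw [← hDdef] at hD hkey'
  have hD0 : D ≠ 0 := hD.ne'
  have hw' : w = D⁻¹ • (l1 • x1 + l3 • x3) := by
    have : (1 + l1 - l2 + l3)⁻¹ = 2⁻¹ * D⁻¹ := by
      rw [← mul_inv]; congr 1; linarith
    rw [hw, this, ← hbary]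
    module
  have hDw : D • w = l1 • x1 + l3 • x3 := by rw [hw', smul_inv_smul₀ hD0]
  have hcancel : ∀ {y z : EuclideanSpace ℝ (Fin 2)}, D • y = D • z → y = z :=
    fun h => smul_right_injective _ hD0 h
  have h1w : x1 - w = (l3 / D) • e := by
    apply hcancel
    rw [smul_smul, mul_div_cancel₀ _ hD0, smul_sub, hDw, he, hDdef]
    module
  have h3w : x3 - w = (-(l1 / D)) • e := by
    apply hcancel
    rw [smul_smul, mul_neg, mul_div_cancel₀ _ hD0, smul_sub, hDw, he, hDdef]
    module
  have hl2D : l2 = 1 - D := by linarith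
  have hpw : p - w = l2 • (x2 - w) := by
    have : p = l2 • x2 + D • w := by rw [hDw, ← hbary]; abel
    rw [this, hl2D]
    module
  have h2p : x2 - p = D • (x2 - w) := by
    rw [← sub_sub_sub_cancel_right x2 p w, hpw, hl2D]
    module
  have hi1 : ⟪x1 - w, e⟫_ℝ ≤ 0 := by
    rw [h1w, real_inner_smul_left, real_inner_self_eq_norm_sq]
    exact mul_nonpos_of_nonpos_of_nonneg (div_nonpos_of_nonpos_of_nonneg hl3.le hD.le) hE.le
  have hi3 : ⟪x3 - w, e⟫_ℝ ≤ 0 := by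
    rw [h3w, real_inner_smul_left, real_inner_self_eq_norm_sq]
    exact mul_nonpos_of_nonpos_of_nonneg (neg_nonpos.2 (by positivity)) hE.le
  have hi2 : 0 < ⟪x2 - w, e⟫_ℝ := by
    have h : ⟪x2 - w, e⟫_ℝ = (l3 * ‖e‖ ^ 2 - D * A) / D := by
      rw [← sub_add_sub_cancel x2 x1 w, inner_add_left, h1w, real_inner_smul_left,
        real_inner_self_eq_norm_sq, he, ← neg_sub x3 x1, inner_neg_right, ← hA]
      field_simp
      ring
    rw [h]
    exact div_pos (by linarith) hD
  have hip : 0 < ⟪p - w, e⟫_ℝ := by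
    rw [hpw, real_inner_smul_left]
    exact mul_pos hl2 hi2
  rw [← he] at hf
  have hfmin : f = fun u => ν / 2 * ‖u - w‖ ^ 2 - ν / ‖e‖ ^ 2 * min 0 ⟪e, u - w⟫_ℝ ^ 2 := by
    funext u
    rw [hf, real_inner_comm]
    split_ifs with h
    · rw [min_eq_right h]; ring
    · rw [min_eq_left (not_le.1 h).le]; ring
  have hgrad : ∀ u, HasGradientAt f
      (ν • (u - w) - (2 * (ν / ‖e‖ ^ 2) * min 0 ⟪e, u - w⟫_ℝ) • e) u := fun u => by
    rw [hfmin]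
    exact hasGradientAt_sq_norm_sub_min_sq ν (ν / ‖e‖ ^ 2) e w u
  refine ⟨fun u => (hgrad u).differentiableAt, fun u v => ?_, ?_⟩
  · rw [(hgrad u).gradient, (hgrad v).gradient]
    exact norm_smul_sub_smul_min_sub_le hν.le he0 w u v
  have hf1 : f x1 = -(ν / 2 * (l3 / D) ^ 2 * ‖e‖ ^ 2) := by
    rw [hf, if_pos hi1, h1w, real_inner_smul_right, real_inner_self_eq_norm_sq, norm_smul, mul_pow,
      Real.norm_eq_abs, sq_abs]
    field_simp
    ring
  have hf3 : f x3 = -(ν / 2 * (l1 / D) ^ 2 * ‖e‖ ^ 2) := by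
    rw [hf, if_pos hi3, h3w, real_inner_smul_right, real_inner_self_eq_norm_sq, norm_smul, mul_pow,
      Real.norm_eq_abs, sq_abs]
    field_simp
    ring
  have hf2 : f x2 = ν / 2 * ‖x2 - w‖ ^ 2 := by rw [hf, if_neg hi2.not_ge]
  have hfp : f p = ν / 2 * (l2 ^ 2 * ‖x2 - w‖ ^ 2) := by
    rw [hf, if_neg hip.not_ge, hpw, norm_smul, mul_pow, Real.norm_eq_abs, sq_abs]
  have hfhatp : fhat p = l1 * f x1 + l2 * f x2 + l3 * f x3 := by
    have hlin : ∀ y, fhat y = fhat.linear y + fhat 0 := fun y => by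
      simpa using fhat.map_vadd 0 y
    rw [← hfhat1, ← hfhat2, ← hfhat3, hlin p, hlin x1, hlin x2, hlin x3, ← hbary]
    simp only [map_add, map_smul, smul_eq_mul]
    linear_combination -(fhat 0) * hsum
  have hPdet : IsUnit P.det := by
    rw [isUnit_iff_ne_zero]
    intro h0
    obtain ⟨v, hv, hPv⟩ := exists_mulVec_eq_zero_iff.2 h0
    have hab : v 0 • (x2 - p) + v 1 • (x1 - x3) = 0 := by
      ext r
      have := congrFun hPv r
      simp only [mulVec, dotProduct, Fin.sum_univ_two, (hP r).1, (hP r).2, Pi.zero_apply] at this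
      simp only [PiLp.add_apply, PiLp.smul_apply, smul_eq_mul, PiLp.zero_apply]
      linarith
    obtain ⟨ha, hb⟩ := eq_zero_of_smul_sub_add_smul_sub_eq_zero hx hsum hbary
      (hDdef ▸ hD0) hab
    apply hv
    ext i
    fin_cases i
    · exact ha
    · exact hb
  have hHP : Hstar * P = P * Matrix.diagonal ![ν, -ν] := by
    rw [hHstar, nonsing_inv_mul_cancel_right _ _ hPdet]
  have hHe : Hstar *ᵥ e.ofLp = (-ν) • e.ofLp := by
    ext r
    have := congrFun (congrFun hHP r) 1
    simp only [mul_apply, Fin.sum_univ_two, (hP _).2, diagonal_apply, ← he] at this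
    simp [mulVec, dotProduct, Fin.sum_univ_two] at this ⊢
    linarith
  have hHa : Hstar *ᵥ (x2 - w).ofLp = ν • (x2 - w).ofLp := by
    ext r
    have := congrFun (congrFun hHP r) 0
    simp only [mul_apply, Fin.sum_univ_two, (hP _).1, diagonal_apply, h2p, PiLp.smul_apply,
      smul_eq_mul] at this
    simp [mulVec, dotProduct, Fin.sum_univ_two] at this ⊢
    exact mul_left_cancel₀ hD0 (by linear_combination this)
  have hG' : G = (l2 * D) • vecMulVec (x2 - w).ofLp (x2 - w).ofLp
      + (l1 * l3 / D) • vecMulVec e.ofLp e.ofLp := by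
    have e1 : x1 = w + (l3 / D) • e := by rw [← h1w]; abel
    have e3 : x3 = w + (-(l1 / D)) • e := by rw [← h3w]; abel
    have ep : p = w + l2 • (x2 - w) := by rw [← hpw]; abel
    obtain ⟨d, hd⟩ : ∃ d, d = x2 - w := ⟨_, rfl⟩
    have e2 : x2 = w + d := by rw [hd]; abel
    rw [← hd] at ep ⊢
    rw [hG, ep, e2, e1, e3]
    ext i j
    simp only [Matrix.add_apply, Matrix.smul_apply, vecMulVec_apply, PiLp.add_apply, PiLp.smul_apply,
      smul_eq_mul]
    obtain rfl : l1 = D - l3 := by linarith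
    rw [hl2D]
    field_simp
    ring
  rw [hG', add_mul, trace_add, smul_mul, smul_mul, trace_smul, trace_smul,
    trace_vecMulVec_self_mul_of_mulVec_eq _ _ hHe, trace_vecMulVec_self_mul_of_mulVec_eq _ _ hHa,
    hfhatp, hf1, hf2, hf3, hfp, smul_eq_mul, smul_eq_mul]
  obtain rfl : l1 = D - l3 := by linarith
  rw [hl2D]
  field_simp
  ring
end
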